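/- arXiv:2502.09377 — 2 statements merged into one kernel-verified Lean document; each statement's English description precedes it below -/
import Mathlib

section
/- Suppose that for every fair division instance with additive valuations and any number n' of agents there exists an allocation without copies giving each agent i a bundle of value at least μ_i^{4⌈n'/3⌉}(M). Then for every fair division instance with additive valuations, n ≥ 5 agents, and m goods, there exists an allocation with copies (A_1,…,A_n) such that v_i(A_i) ≥ μ_i^n(M) for every agent i, each good belongs to at most two bundles, and the number of goods belonging to two bundles is at most ⌊(1/3 + 4/n)·m⌋ + ⌈((4/3 + 4/n)²/(n − 4/3 − 4/n))·m⌉. -/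
open Finset

/-- The `d`-maximin share of valuation `v` over the set `S` of goods:
the maximum over partitions of `S` into `d` bundles of the minimum bundle value. -/
noncomputable def mms {G : Type*} (v : Finset G → ℝ) (d : ℕ) (S : Finset G) : ℝ :=
  ⨆ P : G → Fin d, ⨅ j : Fin d, v (S.filter fun g => P g = j)

/-- The `d`-maximin share is attained by some partition into `d` bundles. -/
theorem exists_partition_mms_le {G : Type*} [Fintype G] (v : Finset G → ℝ) {d : ℕ} (hd : 0 < d)
    (S : Finset G) : ∃ P : G → Fin d, ∀ j, mms v d S ≤ v (S.filter fun g => P g = j) := by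
  classical
  have : Nonempty (Fin d) := ⟨⟨0, hd⟩⟩
  obtain ⟨P, hP⟩ := exists_eq_ciSup_of_finite
    (f := fun P : G → Fin d => ⨅ j : Fin d, v (S.filter fun g => P g = j))
  refine ⟨P, fun j => ?_⟩
  unfold mms
  rw [← hP]
  exact ciInf_le (Set.finite_range _).bddBelow j

theorem le_mms {G : Type*} [Fintype G] (v : Finset G → ℝ) {d : ℕ} (hd : 0 < d)
    (S : Finset G) {x : ℝ} (P : G → Fin d) (hP : ∀ j, x ≤ v (S.filter fun g => P g = j)) :
    x ≤ mms v d S := by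
  have : Nonempty (Fin d) := ⟨⟨0, hd⟩⟩
  exact le_ciSup_of_le (Set.finite_range _).bddAbove P (le_ciInf hP)

theorem mms_nonneg {G : Type*} {w : G → ℝ} (hw : ∀ g, 0 ≤ w g) (d : ℕ) (S : Finset G) :
    0 ≤ mms (fun S => ∑ g ∈ S, w g) d S :=
  Real.iSup_nonneg fun _ => Real.iInf_nonneg fun _ => Finset.sum_nonneg fun g _ => hw g

/-- The maximin share of a nonnegative additive valuation decreases with the number of bundles. -/
theorem mms_le_mms {G : Type*} [Fintype G] {w : G → ℝ} (hw : ∀ g, 0 ≤ w g) {d e : ℕ}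
    (hd : 0 < d) (hde : d ≤ e) (S : Finset G) :
    mms (fun S => ∑ g ∈ S, w g) e S ≤ mms (fun S => ∑ g ∈ S, w g) d S := by
  obtain ⟨P, hP⟩ := exists_partition_mms_le (fun S => ∑ g ∈ S, w g) (hd.trans_le hde) S
  refine le_mms _ hd S (fun g => ⟨min (P g).1 (d - 1), by omega⟩) fun j => ?_
  refine (hP ⟨j.1, by omega⟩).trans ?_
  refine Finset.sum_le_sum_of_subset_of_nonneg (fun g hg => ?_) fun g _ _ => hw g
  simp only [Finset.mem_filter, Fin.ext_iff] at hg ⊢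
  refine ⟨hg.1, ?_⟩
  have := j.2
  omega

/-- The set `S` contains at least `d` disjoint bundles of `w`-value at least `x`. -/
def Covers {G : Type*} (w : G → ℝ) (x : ℝ) (d : ℕ) (S : Finset G) : Prop :=
  ∃ (f : G → ℕ) (J : Finset ℕ), d ≤ J.card ∧ ∀ j ∈ J, x ≤ ∑ g ∈ S with f g = j, w g

theorem covers_mms {G : Type*} [Fintype G] (w : G → ℝ) {d : ℕ} (hd : 0 < d) (S : Finset G) :
    Covers w (mms (fun S => ∑ g ∈ S, w g) d S) d S := by
  obtain ⟨P, hP⟩ := exists_partition_mms_le (fun S => ∑ g ∈ S, w g) hd S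
  refine ⟨fun g => P g, Finset.range d, by simp, fun j hj => ?_⟩
  simpa [Fin.ext_iff] using hP ⟨j, Finset.mem_range.1 hj⟩

theorem Covers.mono {G : Type*} {w : G → ℝ} {x : ℝ} {d e : ℕ} {S : Finset G}
    (h : Covers w x e S) (hde : d ≤ e) : Covers w x d S := by
  obtain ⟨f, J, hJ, hS⟩ := h
  exact ⟨f, J, hde.trans hJ, hS⟩

/-- Removing one good destroys at most one bundle. -/
theorem Covers.erase {G : Type*} [DecidableEq G] {w : G → ℝ} {x : ℝ} {d : ℕ} {S : Finset G}
    (h : Covers w x (d + 1) S) (g : G) : Covers w x d (S.erase g) := by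
  obtain ⟨f, J, hJ, hS⟩ := h
  refine ⟨f, J.erase (f g), ?_, fun j hj => ?_⟩
  · have := Finset.pred_card_le_card_erase (s := J) (a := f g)
    omega
  · obtain ⟨hne, hj⟩ := Finset.mem_erase.1 hj
    convert hS j hj using 2
    ext a
    simp only [Finset.mem_filter, Finset.mem_erase]
    constructor
    · rintro ⟨⟨-, h1⟩, h2⟩
      exact ⟨h1, h2⟩
    · rintro ⟨h1, h2⟩
      refine ⟨⟨?_, h1⟩, h2⟩
      rintro rfl
      exact hne h2.symm

theorem Covers.mul_le_sum {G : Type*} {w : G → ℝ} (hw : ∀ g, 0 ≤ w g) {x : ℝ} (hx : 0 ≤ x)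
    {d : ℕ} {S : Finset G} (h : Covers w x d S) : d * x ≤ ∑ g ∈ S, w g := by
  obtain ⟨f, J, hJ, hS⟩ := h
  calc (d : ℝ) * x ≤ J.card * x := by gcongr
    _ ≤ ∑ j ∈ J, ∑ g ∈ S with f g = j, w g := by
      simpa [nsmul_eq_mul] using Finset.card_nsmul_le_sum J _ x hS
    _ ≤ ∑ g ∈ S, w g :=
      Finset.sum_fiberwise_le_sum_of_sum_fiber_nonneg fun _ _ =>
        Finset.sum_nonneg fun g _ => hw g

/-- If bundle `X` goes to agent `i` and the goods in `S \ X` can be allocated to the other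
agents of `T`, then the goods in `S` can be allocated to the agents of `T`. -/
theorem exists_allocation_of_sdiff {ι G : Type*} [DecidableEq ι] [DecidableEq G]
    {w : ι → G → ℝ} {x : ι → ℝ} {T : Finset ι} {S X : Finset G} {i : ι} (hX : X ⊆ S)
    (hi : x i ≤ ∑ g ∈ X, w i g)
    (h : ∃ B : ι → Finset G, (∀ j k, j ≠ k → Disjoint (B j) (B k)) ∧ (∀ j, B j ⊆ S \ X) ∧
      ∀ j ∈ T.erase i, x j ≤ ∑ g ∈ B j, w j g) :
    ∃ B : ι → Finset G, (∀ j k, j ≠ k → Disjoint (B j) (B k)) ∧ (∀ j, B j ⊆ S) ∧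
      ∀ j ∈ T, x j ≤ ∑ g ∈ B j, w j g := by
  obtain ⟨B, hB, hS, hT⟩ := h
  have hdisj : ∀ j, Disjoint X (B j) := fun j =>
    Finset.disjoint_of_subset_right (hS j) Finset.disjoint_sdiff
  refine ⟨Function.update B i X, fun j k hjk => ?_, fun j => ?_, fun j hj => ?_⟩
  · by_cases hj : j = i
    · subst hj
      rw [Function.update_self, Function.update_of_ne hjk.symm]
      exact hdisj k
    · by_cases hk : k = i
      · subst hk
        rw [Function.update_self, Function.update_of_ne hjk]
        exact (hdisj j).symm
      · rw [Function.update_of_ne hj, Function.update_of_ne hk]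
        exact hB j k hjk
  · by_cases hj : j = i
    · subst hj
      rwa [Function.update_self]
    · rw [Function.update_of_ne hj]
      exact (hS j).trans Finset.sdiff_subset
  · by_cases hji : j = i
    · subst hji
      rwa [Function.update_self]
    · rw [Function.update_of_ne hji]
      exact hT j (Finset.mem_erase.2 ⟨hji, hj⟩)

/-- Bag filling: if every good is worth less than `x i` to agent `i`, and all goods together are
worth at least `(2k - 1) x i`, then all `k` agents can be satisfied. -/
theorem exists_allocation_of_small_goods {ι G : Type*} [DecidableEq ι] [DecidableEq G]
    {w : ι → G → ℝ} {x : ι → ℝ} (hx : ∀ i, 0 ≤ x i) (k : ℕ) (T : Finset ι) (hk : T.card = k)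
    (S : Finset G) (hsmall : ∀ i ∈ T, ∀ g ∈ S, w i g < x i)
    (hsum : ∀ i ∈ T, (2 * k - 1 : ℝ) * x i ≤ ∑ g ∈ S, w i g) :
    ∃ B : ι → Finset G, (∀ i j, i ≠ j → Disjoint (B i) (B j)) ∧ (∀ i, B i ⊆ S) ∧
      ∀ i ∈ T, x i ≤ ∑ g ∈ B i, w i g := by
  induction k generalizing T S with
  | zero =>
    rw [Finset.card_eq_zero] at hk
    subst hk
    exact ⟨fun _ => ∅, by simp, by simp, by simp⟩
  | succ k ih =>
    obtain ⟨a, ha⟩ := Finset.card_pos.1 (by omega : 0 < T.card)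
    have hne : ({X ∈ S.powerset | ∃ i ∈ T, x i ≤ ∑ g ∈ X, w i g}).Nonempty := by
      refine ⟨S, Finset.mem_filter.2 ⟨Finset.mem_powerset_self S, a, ha, ?_⟩⟩
      have := hsum a ha
      push_cast at this
      nlinarith [mul_nonneg (Nat.cast_nonneg (α := ℝ) k) (hx a)]
    obtain ⟨X, hX, hmin⟩ := Finset.exists_min_image _ Finset.card hne
    simp only [Finset.mem_filter, Finset.mem_powerset] at hX hmin
    obtain ⟨hXS, i, hi, hXi⟩ := hX
    refine exists_allocation_of_sdiff hXS hXi
      (ih (T.erase i) (by rw [Finset.card_erase_of_mem hi]; omega) (S \ X)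
        (fun j hj g hg => hsmall j (Finset.mem_of_mem_erase hj) g (Finset.mem_sdiff.1 hg).1)
        fun j hj => ?_)
    have hj := Finset.mem_of_mem_erase hj
    have hle : ∑ g ∈ X, w j g ≤ 2 * x j := by
      rcases X.eq_empty_or_nonempty with rfl | ⟨g, hg⟩
      · simpa using hx j
      · have hlt : ∑ a ∈ X.erase g, w j a < x j := by
          by_contra! hcon
          have := hmin (X.erase g) ⟨(Finset.erase_subset g X).trans hXS, j, hj, hcon⟩
          have := Finset.card_erase_lt_of_mem hg
          omega
        have := Finset.add_sum_erase X (w j) hg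
        linarith [hsmall j hj g (hXS hg)]
    have := Finset.sum_sdiff (f := w j) hXS
    have := hsum j hj
    push_cast at this
    linarith

/-- `k` agents can be allocated disjoint bundles reaching their `(2k - 1)`-maximin shares. -/
theorem exists_allocation_of_covers {ι G : Type*} [DecidableEq ι] [DecidableEq G]
    {w : ι → G → ℝ} (hw : ∀ i g, 0 ≤ w i g) {x : ι → ℝ} (hx : ∀ i, 0 ≤ x i) (k : ℕ)
    (T : Finset ι) (hk : T.card = k) (S : Finset G)
    (h : ∀ i ∈ T, Covers (w i) (x i) (2 * k - 1) S) :
    ∃ B : ι → Finset G, (∀ i j, i ≠ j → Disjoint (B i) (B j)) ∧ (∀ i, B i ⊆ S) ∧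
      ∀ i ∈ T, x i ≤ ∑ g ∈ B i, w i g := by
  induction k generalizing T S with
  | zero =>
    rw [Finset.card_eq_zero] at hk
    subst hk
    exact ⟨fun _ => ∅, by simp, by simp, by simp⟩
  | succ k ih =>
    by_cases hbig : ∃ i ∈ T, ∃ g ∈ S, x i ≤ w i g
    · obtain ⟨i, hi, g, hg, hxg⟩ := hbig
      refine exists_allocation_of_sdiff (Finset.singleton_subset_iff.2 hg) (by simpa using hxg)
        (ih (T.erase i) (by rw [Finset.card_erase_of_mem hi]; omega) _ fun j hj => ?_)
      rw [Finset.sdiff_singleton_eq_erase]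
      exact (Covers.erase (d := 2 * k) (h j (Finset.mem_of_mem_erase hj)) g).mono (by omega)
    · push Not at hbig
      refine exists_allocation_of_small_goods hx (k + 1) T hk S hbig fun i hi => ?_
      have := (h i hi).mul_le_sum (hw i) (hx i)
      rw [show 2 * (k + 1) - 1 = 2 * k + 1 by omega] at this
      push_cast at this ⊢
      linarith

/-- Some `k` elements of `T` have at most average total weight. -/
theorem exists_subset_card_mul_sum_le {ι : Type*} [DecidableEq ι] (f : ι → ℕ) (t : ℕ)
    (T : Finset ι) (ht : T.card = t) {k : ℕ} (hk : k ≤ t) :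
    ∃ U ⊆ T, U.card = k ∧ t * ∑ i ∈ U, f i ≤ k * ∑ i ∈ T, f i := by
  induction t generalizing T with
  | zero => exact ⟨∅, by simp, by simp; omega, by simp⟩
  | succ t ih =>
    rcases hk.eq_or_lt with rfl | hlt
    · exact ⟨T, subset_rfl, ht, le_rfl⟩
    rcases Nat.eq_zero_or_pos t with rfl | htpos
    · exact ⟨∅, by simp, by simp; omega, by simp⟩
    obtain ⟨a, ha, hmax⟩ := Finset.exists_max_image T f (Finset.card_pos.1 (by omega))
    obtain ⟨U, hU, hUk, hsum⟩ := ih (T.erase a) (by rw [Finset.card_erase_of_mem ha]; omega)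
      (by omega)
    refine ⟨U, hU.trans (Finset.erase_subset a T), hUk, ?_⟩
    have h1 := Finset.add_sum_erase T f ha
    have h2 : ∑ i ∈ T, f i ≤ (t + 1) * f a := by
      simpa [ht] using Finset.sum_le_card_nsmul T f (f a) hmax
    have h3 : (t + 1) * ∑ i ∈ T.erase a, f i ≤ t * ∑ i ∈ T, f i := by nlinarith
    refine Nat.le_of_mul_le_mul_left ?_ htpos
    calc t * ((t + 1) * ∑ i ∈ U, f i) = (t + 1) * (t * ∑ i ∈ U, f i) := by ring
      _ ≤ (t + 1) * (k * ∑ i ∈ T.erase a, f i) := by gcongr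
      _ = k * ((t + 1) * ∑ i ∈ T.erase a, f i) := by ring
      _ ≤ k * (t * ∑ i ∈ T, f i) := by gcongr
      _ = t * (k * ∑ i ∈ T, f i) := by ring

/-- If any `k` of the `n ≤ 2k` agents can be satisfied by disjoint bundles, then all agents can be
satisfied by using every good at most twice and at most a fraction `(n - k) / k` of them twice. -/
theorem exists_allocation_with_copies {ι G : Type*} [Fintype ι] [DecidableEq ι] [Fintype G]
    [DecidableEq G] {w : ι → G → ℝ} {x : ι → ℝ} {k : ℕ} (hk : k ≤ Fintype.card ι)
    (hk' : Fintype.card ι ≤ 2 * k)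
    (h : ∀ T : Finset ι, T.card = k → ∃ B : ι → Finset G,
      (∀ i j, i ≠ j → Disjoint (B i) (B j)) ∧ ∀ i ∈ T, x i ≤ ∑ g ∈ B i, w i g) :
    ∃ A : ι → Finset G, (∀ i, x i ≤ ∑ g ∈ A i, w i g) ∧
      (∀ g : G, (Finset.univ.filter fun i => g ∈ A i).card ≤ 2) ∧
      k * (Finset.univ.filter fun g : G =>
        (Finset.univ.filter fun i => g ∈ A i).card = 2).card ≤
        (Fintype.card ι - k) * Fintype.card G := by
  obtain ⟨T, -, hT⟩ := Finset.exists_subset_card_eq (s := (Finset.univ : Finset ι)) (n := k) hk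
  obtain ⟨B, hB, hBT⟩ := h T hT
  obtain ⟨U, hUT, hU, hsum⟩ := exists_subset_card_mul_sum_le (fun i => (B i).card) k T hT
    (k := Fintype.card ι - k) (by omega)
  obtain ⟨C, hC, hCU⟩ := h Uᶜ (by rw [Finset.card_compl]; omega)
  have hone : ∀ D : ι → Finset G, (∀ i j, i ≠ j → Disjoint (D i) (D j)) → ∀ g,
      (Finset.univ.filter fun i => g ∈ D i).card ≤ 1 := by
    intro D hD g
    refine Finset.card_le_one.2 fun i hi j hj => ?_
    by_contra hij
    exact Finset.disjoint_left.1 (hD i j hij) (Finset.mem_filter.1 hi).2 (Finset.mem_filter.1 hj).2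
  refine ⟨fun i => if i ∈ U then B i else C i, fun i => ?_, fun g => ?_, ?_⟩
  · by_cases hi : i ∈ U
    · simpa [hi] using hBT i (hUT hi)
    · simpa [hi] using hCU i (by simpa using hi)
  · calc (Finset.univ.filter fun i => g ∈ if i ∈ U then B i else C i).card
        ≤ ((Finset.univ.filter fun i => g ∈ B i) ∪ Finset.univ.filter fun i => g ∈ C i).card := by
          refine Finset.card_le_card fun i hi => ?_
          by_cases hiU : i ∈ U <;> simp_all
      _ ≤ 1 + 1 := (Finset.card_union_le _ _).trans (Nat.add_le_add (hone B hB g) (hone C hC g))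
  · have hdup : (Finset.univ.filter fun g : G =>
        (Finset.univ.filter fun i => g ∈ if i ∈ U then B i else C i).card = 2) ⊆ U.biUnion B := by
      intro g hg
      by_contra hgU
      simp only [Finset.mem_biUnion, not_exists, not_and] at hgU
      have hle : (Finset.univ.filter fun i => g ∈ if i ∈ U then B i else C i).card ≤ 1 := by
        refine (Finset.card_le_card fun i hi => ?_).trans (hone C hC g)
        by_cases hiU : i ∈ U <;> simp_all
      have := (Finset.mem_filter.1 hg).2
      omega
    have hT' : ∑ i ∈ T, (B i).card ≤ Fintype.card G := by
      rw [← Finset.card_biUnion fun i _ j _ hij => hB i j hij]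
      exact Finset.card_le_univ _
    calc _ ≤ k * ∑ i ∈ U, (B i).card := by
          gcongr
          exact (Finset.card_le_card hdup).trans Finset.card_biUnion_le
      _ ≤ (Fintype.card ι - k) * ∑ i ∈ T, (B i).card := hsum
      _ ≤ _ := by gcongr

/-- A bound on the fraction of duplicated goods yields the floor-plus-ceiling bound. -/
theorem le_floor_add_ceil {c k n m : ℕ} (hn : 5 ≤ n) (hk : 0 < k)
    (hcount : k * c ≤ (n - k) * m) (hkn : k ≤ n) (hfrac : 9 * n * n ≤ (12 * n + 52) * k) :
    c ≤ ⌊(1 / 3 + 4 / (n : ℝ)) * m⌋₊ +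
      ⌈((4 / 3 + 4 / (n : ℝ)) ^ 2 / ((n : ℝ) - 4 / 3 - 4 / (n : ℝ))) * m⌉₊ := by
  have hn' : (5 : ℝ) ≤ n := by exact_mod_cast hn
  have hk' : (0 : ℝ) < k := by exact_mod_cast hk
  have hinv : 4 / (n : ℝ) ≤ 4 / 5 := by gcongr
  have hinv0 : 0 < 4 / (n : ℝ) := by positivity
  have hsecond : 16 / (9 * (n : ℝ)) ≤
      (4 / 3 + 4 / (n : ℝ)) ^ 2 / ((n : ℝ) - 4 / 3 - 4 / (n : ℝ)) := by
    rw [← div_div]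
    apply div_le_div₀ <;> nlinarith
  have hcount' : (k : ℝ) * c ≤ (n - k) * m := by
    rw [← Nat.cast_sub hkn]
    exact_mod_cast hcount
  have hratio : ((n : ℝ) - k) ≤ (1 / 3 + 4 / n + 16 / (9 * n)) * k := by
    have hfrac' : (9 * n * n : ℝ) ≤ (12 * n + 52) * k := by exact_mod_cast hfrac
    rw [show (1 / 3 + 4 / (n : ℝ) + 16 / (9 * n)) * k = (3 * n + 52) * k / (9 * n) by
      field_simp; ring]
    rw [le_div_iff₀ (by positivity)]
    nlinarith
  have hc : (c : ℝ) ≤ (1 / 3 + 4 / (n : ℝ)) * m +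
      ((4 / 3 + 4 / (n : ℝ)) ^ 2 / ((n : ℝ) - 4 / 3 - 4 / (n : ℝ))) * m := by
    have h1 : (k : ℝ) * c ≤ k * ((1 / 3 + 4 / n + 16 / (9 * n)) * m) :=
      hcount'.trans (by
        calc _ ≤ (1 / 3 + 4 / n + 16 / (9 * n)) * k * (m : ℝ) := by gcongr
          _ = _ := by ring)
    refine (le_of_mul_le_mul_left h1 hk').trans ?_
    rw [← add_mul]
    gcongr
  rw [← Nat.lt_succ_iff, ← Nat.cast_lt (α := ℝ)]
  push_cast
  linarith [Nat.lt_floor_add_one ((1 / 3 + 4 / (n : ℝ)) * m),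
    Nat.le_ceil (((4 / 3 + 4 / (n : ℝ)) ^ 2 / ((n : ℝ) - 4 / 3 - 4 / (n : ℝ))) * m)]

/-- If every additive instance with `n'` agents admits a
1-out-of-`4⌈n'/3⌉` MMS allocation (without copies), then every additive instance with
`n ≥ 5` agents and `m` goods admits a full MMS allocation with copies in which every good
belongs to at most two bundles and the number of goods belonging to two bundles is at most
`⌊(1/3 + 4/n)·m⌋ + ⌈((4/3 + 4/n)²/(n − 4/3 − 4/n))·m⌉`.
(Here `⌈n'/3⌉` is written as `(n' + 2) / 3` using natural division.) -/
theorem stmt8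
    (hyp : ∀ (G : Type) (_ : Fintype G) (_ : DecidableEq G) (n' : ℕ), 0 < n' →
      ∀ w : Fin n' → G → ℝ, (∀ i g, 0 ≤ w i g) →
        ∃ B : Fin n' → Finset G,
          (∀ i j, i ≠ j → Disjoint (B i) (B j)) ∧
          (Finset.univ.biUnion B = Finset.univ) ∧
          (∀ i, mms (fun S => ∑ g ∈ S, w i g) (4 * ((n' + 2) / 3)) Finset.univ ≤
            ∑ g ∈ B i, w i g)) :
    ∀ (G : Type) (_ : Fintype G) (_ : DecidableEq G) (n : ℕ), 5 ≤ n →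
      ∀ w : Fin n → G → ℝ, (∀ i g, 0 ≤ w i g) →
        ∃ A : Fin n → Finset G,
          (∀ i, mms (fun S => ∑ g ∈ S, w i g) n Finset.univ ≤ ∑ g ∈ A i, w i g) ∧
          (∀ g : G, (Finset.univ.filter fun i => g ∈ A i).card ≤ 2) ∧
          (Finset.univ.filter fun g : G =>
            (Finset.univ.filter fun i => g ∈ A i).card = 2).card ≤
            ⌊(1 / 3 + 4 / (n : ℝ)) * (Fintype.card G : ℝ)⌋₊ +
            ⌈((4 / 3 + 4 / (n : ℝ)) ^ 2 / ((n : ℝ) - 4 / 3 - 4 / (n : ℝ))) *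
              (Fintype.card G : ℝ)⌉₊ := by
  intro G _ _ n hn w hw
  suffices h : ∃ k : ℕ, 0 < k ∧ k ≤ n ∧ n ≤ 2 * k ∧ 9 * n * n ≤ (12 * n + 52) * k ∧
      ∀ T : Finset (Fin n), T.card = k → ∃ B : Fin n → Finset G,
        (∀ i j, i ≠ j → Disjoint (B i) (B j)) ∧
        ∀ i ∈ T, mms (fun S => ∑ g ∈ S, w i g) n Finset.univ ≤ ∑ g ∈ B i, w i g by
    obtain ⟨k, hk, hkn, hnk, hfrac, hT⟩ := h
    obtain ⟨A, hA, hA2, hcount⟩ := exists_allocation_with_copies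
      (by simpa using hkn) (by simpa using hnk) hT
    rw [Fintype.card_fin] at hcount
    exact ⟨A, hA, hA2, le_floor_add_ceil hn hk hcount hkn hfrac⟩
  by_cases h7 : n = 7
  · subst h7
    refine ⟨4, by norm_num, by norm_num, by norm_num, by norm_num, fun T hT => ?_⟩
    obtain ⟨B, hB, -, hBT⟩ := exists_allocation_of_covers hw
      (fun i => mms_nonneg (hw i) 7 Finset.univ) 4 T hT Finset.univ
      fun i _ => covers_mms (w i) (by norm_num) Finset.univ
    exact ⟨B, hB, hBT⟩
  · obtain ⟨q, r, hr, rfl⟩ : ∃ q r, r < 4 ∧ n = 4 * q + r :=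
      ⟨n / 4, n % 4, Nat.mod_lt _ (by norm_num), (Nat.div_add_mod n 4).symm⟩
    refine ⟨3 * q, by omega, by omega, by omega, ?_, fun T hT => ?_⟩
    · have : r = 3 → 2 ≤ q := by omega
      interval_cases r <;> ring_nf <;> omega
    · obtain ⟨B, hB, -, hBT⟩ := hyp G inferInstance inferInstance (3 * q) (by omega)
        (fun j => w (T.equivFinOfCardEq hT |>.symm j)) fun j g => hw _ g
      refine ⟨fun i => if hi : i ∈ T then B (T.equivFinOfCardEq hT ⟨i, hi⟩) else ∅,
        fun i j hij => ?_, fun i hi => ?_⟩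
      · by_cases hi : i ∈ T <;> by_cases hj : j ∈ T <;> simp only [hi, hj, dite_true, dite_false,
          Finset.disjoint_empty_left, Finset.disjoint_empty_right]
        exact hB _ _ fun h => hij (by simpa using h)
      · have := hBT (T.equivFinOfCardEq hT ⟨i, hi⟩)
        simp only [Equiv.symm_apply_apply] at this
        simp only [hi, dite_true]
        exact (mms_le_mms (hw i) (by omega) (by omega) _).trans this
end

section
/- For every fair division instance with n > 5 agents and additive valuations, and every α with 0 ≤ α ≤ 4/5, there exists an allocation with copies (A_1,…,A_n) such that v_i(A_i) ≥ α·μ_i^n(M) for every agent i, each good belongs to at most two of the bundles, and at most ⌊n/3⌋ goods belong to two bundles (i.e., a 4/5-approximate MMS allocation using at most ⌊n/3⌋ distinct copies, each good copied at most once). -/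
open Finset

/-- `v` has `n` pairwise disjoint bundles of value at least `5`, all disjoint from `T`. -/
def BundlesAvoiding (v : ℕ → ℝ) (T : Finset ℕ) (n : ℕ) : Prop :=
  ∃ (I : Finset ℕ) (B : ℕ → Finset ℕ), n ≤ I.card ∧
    (∀ i ∈ I, ∀ j ∈ I, i ≠ j → Disjoint (B i) (B j)) ∧
    (∀ j ∈ I, Disjoint (B j) T) ∧ ∀ j ∈ I, 5 ≤ ∑ g ∈ B j, v g

/-- The increasing enumeration of the natural numbers outside `T`. -/
noncomputable def survivors (T : Finset ℕ) : ℕ ↪o ℕ :=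
  haveI : Infinite ((T : Set ℕ)ᶜ : Set ℕ) := T.finite_toSet.infinite_compl.to_subtype
  haveI : DecidablePred (· ∈ (T : Set ℕ)ᶜ) := Classical.decPred _
  Nat.orderEmbeddingOfSet (T : Set ℕ)ᶜ

lemma range_survivors (T : Finset ℕ) : Set.range (survivors T) = (T : Set ℕ)ᶜ := by
  have : Infinite ((T : Set ℕ)ᶜ : Set ℕ) := T.finite_toSet.infinite_compl.to_subtype
  exact @Nat.orderEmbeddingOfSet_range _ _ (Classical.decPred _)

lemma survivors_notMem (T : Finset ℕ) (g : ℕ) : survivors T g ∉ T := by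
  have : survivors T g ∈ (T : Set ℕ)ᶜ := range_survivors T ▸ Set.mem_range_self g
  simpa using this

lemma exists_survivors_eq {T : Finset ℕ} {g : ℕ} (hg : g ∉ T) : ∃ r, survivors T r = g := by
  have : g ∈ Set.range (survivors T) := by rw [range_survivors]; simpa using hg
  exact this

lemma BundlesAvoiding.comp_survivors {v : ℕ → ℝ} {T : Finset ℕ} {n : ℕ}
    (h : BundlesAvoiding v T n) : BundlesAvoiding (v ∘ survivors T) ∅ n := by
  obtain ⟨I, B, hn, hd, hT, hv⟩ := h
  have hinj := (survivors T).injective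
  refine ⟨I, fun j => (B j).preimage (survivors T) hinj.injOn, hn, ?_, by simp, ?_⟩
  · intro i hi j hj hij
    rw [Finset.disjoint_left]
    intro g hg hg'
    exact Finset.disjoint_left.1 (hd i hi j hj hij) (Finset.mem_preimage.1 hg)
      (Finset.mem_preimage.1 hg')
  · intro j hj
    refine (hv j hj).trans_eq ?_
    symm
    refine Finset.sum_preimage _ _ hinj.injOn _ fun g hg hg' => (hg' ?_).elim
    exact exists_survivors_eq (Finset.disjoint_left.1 (hT j hj) hg)

lemma BundlesAvoiding.exists_le_sum_range {v : ℕ → ℝ} {n : ℕ} (hv : ∀ g, 0 ≤ v g)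
    (h : BundlesAvoiding v ∅ n) : ∃ M₀, ∀ M, M₀ ≤ M → 5 * (n : ℝ) ≤ ∑ g ∈ range M, v g := by
  obtain ⟨I, B, hn, hd, -, hB⟩ := h
  refine ⟨(I.biUnion B).sup id + 1, fun M hM => ?_⟩
  calc 5 * (n : ℝ) ≤ ∑ _j ∈ I, (5 : ℝ) := by
        rw [Finset.sum_const, nsmul_eq_mul, mul_comm]
        gcongr
    _ ≤ ∑ j ∈ I, ∑ g ∈ B j, v g := Finset.sum_le_sum hB
    _ = ∑ g ∈ I.biUnion B, v g := (Finset.sum_biUnion fun i hi j hj hij => hd i hi j hj hij).symm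
    _ ≤ ∑ g ∈ range M, v g := by
        refine Finset.sum_le_sum_of_subset_of_nonneg (fun g hg => ?_) fun g _ _ => hv g
        have : g ≤ (I.biUnion B).sup id := Finset.le_sup (f := id) hg
        exact Finset.mem_range.2 (by omega)

/-- The bundles met by `T` may be dropped. -/
lemma BundlesAvoiding.drop {v : ℕ → ℝ} {n m : ℕ} {T I : Finset ℕ} {B : ℕ → Finset ℕ}
    (hn : n + m ≤ I.card) (hd : ∀ i ∈ I, ∀ j ∈ I, i ≠ j → Disjoint (B i) (B j))
    (hv : ∀ j ∈ I, 5 ≤ ∑ g ∈ B j, v g)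
    (hm : (I.filter fun j => ¬ Disjoint (B j) T).card ≤ m) : BundlesAvoiding v T n := by
  refine ⟨I.filter fun j => Disjoint (B j) T, B, ?_, ?_, ?_, ?_⟩
  · have := Finset.card_filter_add_card_filter_not (s := I) (fun j => Disjoint (B j) T)
    omega
  · exact fun i hi j hj => hd i (Finset.mem_filter.1 hi).1 j (Finset.mem_filter.1 hj).1
  · exact fun j hj => (Finset.mem_filter.1 hj).2
  · exact fun j hj => hv j (Finset.mem_filter.1 hj).1

/-- Among the goods `0, …, t (n + 1)`, some `t + 1` lie in a common bundle; so the last `t + 1` of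
them can be removed at the cost of a single bundle. -/
lemma BundlesAvoiding.remove_pigeonhole {v : ℕ → ℝ} (hv : Antitone v) {n : ℕ} (t : ℕ)
    (h : BundlesAvoiding v ∅ (n + 1)) :
    BundlesAvoiding v (Icc (t * n) (t * n + t)) n := by
  obtain ⟨I, B, hn, hd, -, hB⟩ := h
  set T := Icc (t * n) (t * n + t) with hT
  have hTcard : T.card = t + 1 := by simp [hT]; omega
  obtain ⟨I, hII, hIcard⟩ := Finset.exists_subset_card_eq hn
  replace hd : ∀ i ∈ I, ∀ j ∈ I, i ≠ j → Disjoint (B i) (B j) :=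
    fun i hi j hj => hd i (hII hi) j (hII hj)
  replace hB : ∀ j ∈ I, 5 ≤ ∑ g ∈ B j, v g := fun j hj => hB j (hII hj)
  let W := range (t * (n + 1) + 1)
  let X : ℕ → Finset ℕ := fun j => W.filter fun g => g ∈ B j ∨ ∀ i ∈ I, g ∉ B i
  obtain ⟨q, hq, hXq⟩ : ∃ q ∈ I, t + 1 ≤ (X q).card := by
    by_contra! hcon
    have h1 : (I.biUnion X).card ≤ I.card * t :=
      Finset.card_biUnion_le_card_mul _ _ _ fun j hj => by have := hcon j hj; omega
    have h2 : W ⊆ I.biUnion X := by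
      intro g hg
      rw [Finset.mem_biUnion]
      by_cases hc : ∃ i ∈ I, g ∈ B i
      · obtain ⟨i, hi, hgi⟩ := hc
        exact ⟨i, hi, Finset.mem_filter.2 ⟨hg, Or.inl hgi⟩⟩
      · push Not at hc
        obtain ⟨i, hi⟩ : I.Nonempty := Finset.card_pos.1 (by omega)
        exact ⟨i, hi, Finset.mem_filter.2 ⟨hg, Or.inr hc⟩⟩
    have h3 := Finset.card_le_card h2
    rw [Finset.card_range] at h3
    rw [hIcard] at h1
    have := mul_comm t (n + 1)
    omega
  obtain ⟨Y, hYX, hYcard⟩ := Finset.exists_subset_card_eq hXq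
  have hYW : ∀ g ∈ Y, g ≤ t * n + t := fun g hg => by
    have := Finset.mem_range.1 (Finset.mem_filter.1 (hYX hg)).1
    rw [mul_add, mul_one] at this
    omega
  have hYB : ∀ j ∈ I, j ≠ q → ∀ g ∈ B j, g ∉ Y := by
    intro j hj hjq g hg hgY
    rcases (Finset.mem_filter.1 (hYX hgY)).2 with h | h
    · exact Finset.disjoint_left.1 (hd j hj q hq hjq) hg h
    · exact h j hj hg
  have hcard : (T \ Y).card = (Y \ T).card :=
    Finset.card_sdiff_comm (by rw [hTcard, hYcard])
  let σ := Finset.equivOfCardEq hcard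
  let ρ : ℕ → ℕ := fun g => if hg : g ∈ T \ Y then σ ⟨g, hg⟩ else g
  have hρ1 : ∀ g (hg : g ∈ T \ Y), ρ g = σ ⟨g, hg⟩ := fun g hg => dif_pos hg
  have hρ2 : ∀ g, g ∉ T \ Y → ρ g = g := fun g hg => dif_neg hg
  have hρT : ∀ g, g ∉ Y → ρ g ∉ T := by
    intro g hg
    by_cases hgT : g ∈ T \ Y
    · rw [hρ1 g hgT]
      exact (Finset.mem_sdiff.1 (σ ⟨g, hgT⟩).2).2
    · rw [hρ2 g hgT]
      exact fun h => hgT (Finset.mem_sdiff.2 ⟨h, hg⟩)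
  have hρinj : ∀ g, g ∉ Y → ∀ g', g' ∉ Y → ρ g = ρ g' → g = g' := by
    intro g hg g' hg' hgg
    by_cases h1 : g ∈ T \ Y <;> by_cases h2 : g' ∈ T \ Y
    · rw [hρ1 g h1, hρ1 g' h2] at hgg
      simpa using σ.injective (Subtype.ext hgg)
    · rw [hρ1 g h1, hρ2 g' h2] at hgg
      exact absurd (Finset.mem_sdiff.1 (σ ⟨g, h1⟩).2).1 (hgg ▸ hg')
    · rw [hρ2 g h1, hρ1 g' h2] at hgg
      exact absurd (Finset.mem_sdiff.1 (σ ⟨g', h2⟩).2).1 (hgg ▸ hg)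
    · rwa [hρ2 g h1, hρ2 g' h2] at hgg
  have hρv : ∀ g, v g ≤ v (ρ g) := by
    intro g
    by_cases h1 : g ∈ T \ Y
    · rw [hρ1 g h1]
      refine hv ?_
      obtain ⟨h3, h4⟩ := Finset.mem_sdiff.1 (σ ⟨g, h1⟩).2
      have h5 := hYW _ h3
      have h6 := Finset.mem_Icc.1 (Finset.mem_sdiff.1 h1).1
      have h7 : ¬ (t * n ≤ (σ ⟨g, h1⟩ : ℕ) ∧ (σ ⟨g, h1⟩ : ℕ) ≤ t * n + t) :=
        fun h => h4 (Finset.mem_Icc.2 h)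
      omega
    · rw [hρ2 g h1]
  refine ⟨I.erase q, fun j => (B j).image ρ, ?_, ?_, ?_, ?_⟩
  · rw [Finset.card_erase_of_mem hq]; omega
  · intro i hi j hj hij
    obtain ⟨hiq, hi⟩ := Finset.mem_erase.1 hi
    obtain ⟨hjq, hj⟩ := Finset.mem_erase.1 hj
    rw [Finset.disjoint_left]
    intro x hx hx'
    obtain ⟨a, ha, rfl⟩ := Finset.mem_image.1 hx
    obtain ⟨b, hb, hab⟩ := Finset.mem_image.1 hx'
    have := hρinj b (hYB j hj hjq b hb) a (hYB i hi hiq a ha) hab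
    exact Finset.disjoint_left.1 (hd i hi j hj hij) ha (this ▸ hb)
  · intro j hj
    obtain ⟨hjq, hj⟩ := Finset.mem_erase.1 hj
    rw [Finset.disjoint_left]
    intro x hx
    obtain ⟨a, ha, rfl⟩ := Finset.mem_image.1 hx
    exact hρT a (hYB j hj hjq a ha)
  · intro j hj
    obtain ⟨hjq, hj⟩ := Finset.mem_erase.1 hj
    rw [Finset.sum_image fun a ha b hb =>
      hρinj a (hYB j hj hjq a ha) b (hYB j hj hjq b hb)]
    exact (hB j hj).trans (Finset.sum_le_sum fun g _ => hρv g)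

/-- `A` gives every agent of `𝒜` value at least `4`, sharing only goods of the set `D` of at most
`k` goods, each by at most two agents. The last condition bounds the shared goods of an agent by
the earlier goods that are neither shared nor hers. -/
structure IsSolution {ι : Type*} (𝒜 : Finset ι) (v : ι → ℕ → ℝ) (k : ℕ) (A : ι → Finset ℕ)
    (D : Finset ℕ) : Prop where
  value : ∀ i ∈ 𝒜, 4 ≤ ∑ g ∈ A i, v i g
  card_le : D.card ≤ k
  two : ∀ g, (𝒜.filter fun i => g ∈ A i).card ≤ 2
  one : ∀ g, g ∉ D → (𝒜.filter fun i => g ∈ A i).card ≤ 1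
  room : ∀ i ∈ 𝒜, ∀ d ∈ A i ∩ D,
    (A i ∩ D).card ≤ 1 + ((range d).filter fun g => g ∉ A i ∧ g ∉ D).card

/-- A solution among the goods outside `T` is extended by agents satisfied by goods of `T`. -/
lemma IsSolution.extend {ι : Type*} [DecidableEq ι] {𝒜 𝒬 : Finset ι} {v : ι → ℕ → ℝ}
    {k k' : ℕ} {A C : ι → Finset ℕ} {D E T : Finset ℕ}
    (hs : IsSolution (𝒜 \ 𝒬) (fun i => v i ∘ survivors T) k' A D)
    (hCT : ∀ i ∈ 𝒬, C i ⊆ T) (hET : E ⊆ T)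
    (hCv : ∀ i ∈ 𝒬, 4 ≤ ∑ g ∈ C i, v i g)
    (hC2 : ∀ g, (𝒬.filter fun i => g ∈ C i).card ≤ 2)
    (hC1 : ∀ g, g ∉ E → (𝒬.filter fun i => g ∈ C i).card ≤ 1)
    (hCE : ∀ i ∈ 𝒬, (C i ∩ E).card ≤ 1) (hk : E.card + k' ≤ k) :
    ∃ A D, IsSolution 𝒜 v k A D := by
  set e := survivors T with he
  set A' : ι → Finset ℕ := fun i => if i ∈ 𝒬 then C i else (A i).map e.toEmbedding with hA'
  have hA1 : ∀ i ∈ 𝒬, A' i = C i := fun i hi => if_pos hi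
  have hA2 : ∀ i, i ∉ 𝒬 → A' i = (A i).map e.toEmbedding := fun i hi => if_neg hi
  have heT : ∀ r, e r ∉ T := survivors_notMem T
  have hmem : ∀ (S : Finset ℕ) r, e r ∈ S.map e.toEmbedding ↔ r ∈ S := fun S r =>
    Finset.mem_map' e.toEmbedding
  have hmapT : ∀ (S : Finset ℕ) g, g ∈ S.map e.toEmbedding → g ∉ T := by
    intro S g hg
    obtain ⟨r, -, rfl⟩ := Finset.mem_map.1 hg
    exact heT r
  set D' := E ∪ D.map e.toEmbedding with hD'
  have hDe : ∀ r, e r ∈ D' ↔ r ∈ D := by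
    intro r
    rw [hD', Finset.mem_union, hmem]
    exact or_iff_right fun h => heT r (hET h)
  have hDT : ∀ g ∈ T, g ∈ D' → g ∈ E := by
    intro g hg h
    rcases Finset.mem_union.1 h with h | h
    · exact h
    · exact absurd hg (hmapT _ _ h)
  have hfT : ∀ g ∈ T, (𝒜.filter fun i => g ∈ A' i) ⊆ 𝒬.filter fun i => g ∈ C i := by
    intro g hg i hi
    obtain ⟨hi, hgi⟩ := Finset.mem_filter.1 hi
    by_cases hiP : i ∈ 𝒬
    · rw [hA1 i hiP] at hgi
      exact Finset.mem_filter.2 ⟨hiP, hgi⟩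
    · rw [hA2 i hiP] at hgi
      exact absurd hg (hmapT _ _ hgi)
  have hfe : ∀ r, (𝒜.filter fun i => e r ∈ A' i) ⊆ (𝒜 \ 𝒬).filter fun i => r ∈ A i := by
    intro r i hi
    obtain ⟨hi, hgi⟩ := Finset.mem_filter.1 hi
    by_cases hiP : i ∈ 𝒬
    · rw [hA1 i hiP] at hgi
      exact absurd (hCT i hiP hgi) (heT r)
    · rw [hA2 i hiP, hmem] at hgi
      exact Finset.mem_filter.2 ⟨Finset.mem_sdiff.2 ⟨hi, hiP⟩, hgi⟩
  refine ⟨A', D', ⟨?_, ?_, ?_, ?_, ?_⟩⟩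
  · intro i hi
    by_cases hiP : i ∈ 𝒬
    · rw [hA1 i hiP]
      exact hCv i hiP
    · rw [hA2 i hiP, Finset.sum_map]
      exact hs.value i (Finset.mem_sdiff.2 ⟨hi, hiP⟩)
  · have h1 : D'.card ≤ E.card + (D.map e.toEmbedding).card := Finset.card_union_le _ _
    rw [Finset.card_map] at h1
    have := hs.card_le
    omega
  · intro g
    by_cases hg : g ∈ T
    · exact (Finset.card_le_card (hfT g hg)).trans (hC2 g)
    · obtain ⟨r, rfl⟩ := exists_survivors_eq hg
      exact (Finset.card_le_card (hfe r)).trans (hs.two r)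
  · intro g hgD
    by_cases hg : g ∈ T
    · exact (Finset.card_le_card (hfT g hg)).trans
        (hC1 g fun h => hgD (Finset.mem_union_left _ h))
    · obtain ⟨r, rfl⟩ := exists_survivors_eq hg
      exact (Finset.card_le_card (hfe r)).trans (hs.one r fun h => hgD ((hDe r).2 h))
  · intro i hi d hd
    by_cases hiP : i ∈ 𝒬
    · rw [hA1 i hiP] at hd ⊢
      have : C i ∩ D' ⊆ C i ∩ E := fun g hg => by
        obtain ⟨h1, h2⟩ := Finset.mem_inter.1 hg
        exact Finset.mem_inter.2 ⟨h1, hDT g (hCT i hiP h1) h2⟩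
      have := (Finset.card_le_card this).trans (hCE i hiP)
      omega
    · rw [hA2 i hiP] at hd ⊢
      obtain ⟨h1, h2⟩ := Finset.mem_inter.1 hd
      obtain ⟨r, hr, rfl⟩ := Finset.mem_map.1 h1
      have h2' : r ∈ D := (hDe r).1 h2
      have h3 : (A i).map e.toEmbedding ∩ D' ⊆ (A i ∩ D).map e.toEmbedding := fun g hg => by
        obtain ⟨h1, h2⟩ := Finset.mem_inter.1 hg
        obtain ⟨r, hr, rfl⟩ := Finset.mem_map.1 h1
        exact Finset.mem_map.2 ⟨r, Finset.mem_inter.2 ⟨hr, (hDe r).1 h2⟩, rfl⟩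
      have h4 := Finset.card_le_card h3
      have h5 : ((range r).filter fun g => g ∉ A i ∧ g ∉ D).map e.toEmbedding ⊆
          (range (e r)).filter fun g => g ∉ (A i).map e.toEmbedding ∧ g ∉ D' := fun g hg => by
        obtain ⟨s, hs, rfl⟩ := Finset.mem_map.1 hg
        obtain ⟨hs1, hs2, hs3⟩ := Finset.mem_filter.1 hs
        refine Finset.mem_filter.2 ⟨Finset.mem_range.2 (e.strictMono (Finset.mem_range.1 hs1)),
          fun h => hs2 ((hmem _ _).1 h), fun h => hs3 ((hDe s).1 h)⟩
      have h6 := Finset.card_le_card h5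
      rw [Finset.card_map] at h4 h6
      have h7 := hs.room i (Finset.mem_sdiff.2 ⟨hi, hiP⟩) r (Finset.mem_inter.2 ⟨hr, h2'⟩)
      exact h4.trans (h7.trans (Nat.add_le_add_left h6 1))

/-- Disjoint groups of bundles may be merged, after discarding the goods of `T`. -/
lemma BundlesAvoiding.merge {v : ℕ → ℝ} {n : ℕ} {T I J : Finset ℕ} {B c : ℕ → Finset ℕ}
    (hd : ∀ i ∈ I, ∀ j ∈ I, i ≠ j → Disjoint (B i) (B j)) (hn : n ≤ J.card)
    (hcI : ∀ j ∈ J, c j ⊆ I) (hcd : ∀ i ∈ J, ∀ j ∈ J, i ≠ j → Disjoint (c i) (c j))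
    (hv : ∀ j ∈ J, 5 ≤ ∑ i ∈ c j, ∑ g ∈ B i \ T, v g) : BundlesAvoiding v T n := by
  refine ⟨J, fun j => (c j).biUnion fun i => B i \ T, hn, ?_, ?_, ?_⟩
  · intro i hi j hj hij
    simp only [Finset.disjoint_biUnion_left, Finset.disjoint_biUnion_right]
    intro a ha b hb
    refine (hd _ (hcI i hi hb) _ (hcI j hj ha) ?_).mono Finset.sdiff_subset Finset.sdiff_subset
    rintro rfl
    exact Finset.disjoint_left.1 (hcd i hi j hj hij) hb ha
  · intro j _
    simp only [Finset.disjoint_biUnion_left]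
    exact fun i _ => Finset.sdiff_disjoint
  · intro j hj
    rw [Finset.sum_biUnion]
    · exact hv j hj
    · exact fun a ha b hb hab => (hd a (hcI j hj ha) b (hcI j hj hb) hab).mono
        Finset.sdiff_subset Finset.sdiff_subset

lemma five_mul_card_sub_le {v : ℕ → ℝ} (hv : ∀ g, 0 ≤ v g) {T S c : Finset ℕ}
    {B : ℕ → Finset ℕ} (hd : ∀ i ∈ c, ∀ j ∈ c, i ≠ j → Disjoint (B i) (B j))
    (hB : ∀ j ∈ c, 5 ≤ ∑ g ∈ B j, v g) (hS : ∀ j ∈ c, B j ∩ T ⊆ S) :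
    5 * (c.card : ℝ) - ∑ g ∈ S, v g ≤ ∑ i ∈ c, ∑ g ∈ B i \ T, v g := by
  have h1 : 5 * (c.card : ℝ) ≤ ∑ i ∈ c, ∑ g ∈ B i, v g := by
    have := Finset.card_nsmul_le_sum c (fun i => ∑ g ∈ B i, v g) 5 hB
    rwa [nsmul_eq_mul, mul_comm] at this
  have h2 : ∑ i ∈ c, ∑ g ∈ B i ∩ T, v g ≤ ∑ g ∈ S, v g := by
    rw [← Finset.sum_biUnion fun i hi j hj hij => (hd i hi j hj hij).mono
      Finset.inter_subset_left Finset.inter_subset_left]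
    exact Finset.sum_le_sum_of_subset_of_nonneg (Finset.biUnion_subset.2 hS) fun g _ _ => hv g
  have h3 : ∑ i ∈ c, ∑ g ∈ B i, v g =
      ∑ i ∈ c, ∑ g ∈ B i ∩ T, v g + ∑ i ∈ c, ∑ g ∈ B i \ T, v g := by
    rw [← Finset.sum_add_distrib]
    exact Finset.sum_congr rfl fun i _ => (Finset.sum_inter_add_sum_sdiff _ _ _).symm
  linarith

/-- Two goods of value below `4` and three of value below `2` can be removed at the cost of three
bundles. -/
lemma BundlesAvoiding.remove_five {v : ℕ → ℝ} (hv : ∀ g, 0 ≤ v g) {n a b x y z : ℕ}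
    (ha : v a < 4) (hb : v b < 4) (hx : v x < 2) (hy : v y < 2) (hz : v z < 2)
    (hxa : x ≠ a) (hxb : x ≠ b) (hya : y ≠ a) (hyb : y ≠ b) (hxy : x ≠ y) (hxz : x ≠ z)
    (hyz : y ≠ z) (hab : a ≠ b) (haz : a ≠ z) (hbz : b ≠ z)
    (h : BundlesAvoiding v ∅ (n + 3)) : BundlesAvoiding v {a, b, x, y, z} n := by
  obtain ⟨I, B, hn, hd, -, hB⟩ := h
  set T : Finset ℕ := {a, b, x, y, z} with hT
  set H := I.filter fun j => ¬ Disjoint (B j) T with hH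
  have hHI : H ⊆ I := Finset.filter_subset _ _
  have hcompl : I.card = (I \ H).card + H.card := by
    rw [Finset.card_sdiff_add_card_eq_card hHI]
  have hgood : ∀ j ∈ I \ H, 5 ≤ ∑ i ∈ ({j} : Finset ℕ), ∑ g ∈ B i \ T, v g := by
    intro j hj
    obtain ⟨h1, h2⟩ := Finset.mem_sdiff.1 hj
    have h3 : Disjoint (B j) T := by
      by_contra h
      exact h2 (Finset.mem_filter.2 ⟨h1, h⟩)
    rw [Finset.sum_singleton, Finset.sdiff_eq_self_of_disjoint h3]
    exact hB j h1
  have hTsum : ∑ g ∈ T, v g = v a + v b + v x + v y + v z := by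
    rw [hT, Finset.sum_insert, Finset.sum_insert, Finset.sum_insert, Finset.sum_pair hyz]
    · ring
    all_goals simp only [Finset.mem_insert, Finset.mem_singleton]; omega
  choose! β hβ using fun t (ht : ∃ j ∈ I, t ∈ B j) => ht
  have hβ' : ∀ j ∈ I, ∀ t ∈ B j, β t = j := by
    intro j hj t ht
    obtain ⟨h1, h2⟩ := hβ t ⟨j, hj, ht⟩
    by_contra hne
    exact Finset.disjoint_left.1 (hd _ h1 _ hj hne) h2 ht
  have hHβ : H ⊆ T.image β := by
    intro j hj
    obtain ⟨h1, h2⟩ := Finset.mem_filter.1 hj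
    obtain ⟨t, ht, htT⟩ := Finset.not_disjoint_iff.1 h2
    exact Finset.mem_image.2 ⟨t, htT, hβ' j h1 t ht⟩
  have hTcard : T.card ≤ 5 := Finset.card_le_five
  have hH5 := (Finset.card_le_card hHβ).trans Finset.card_image_le
  rcases Nat.lt_or_ge H.card 4 with h4 | h4
  · exact BundlesAvoiding.drop hn hd hB (Nat.le_of_lt_succ h4)
  obtain ⟨p, hp⟩ : H.Nonempty := Finset.card_pos.1 (by omega)
  rcases Nat.lt_or_ge H.card 5 with h5 | h5
  · have hH4 : H.card = 4 := by omega
    have hpn : p ∉ I \ H := fun h => (Finset.mem_sdiff.1 h).2 hp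
    refine BundlesAvoiding.merge (J := insert p (I \ H)) (c := fun j => if j = p then H else {j})
      hd ?_ ?_ ?_ ?_
    · rw [Finset.card_insert_of_notMem hpn]
      omega
    · intro j hj
      split_ifs with hjp
      · exact hHI
      · have := Finset.mem_of_mem_insert_of_ne hj hjp
        exact Finset.singleton_subset_iff.2 (Finset.mem_sdiff.1 this).1
    · intro i hi j hj hij
      rw [Finset.mem_insert, Finset.mem_sdiff] at hi hj
      split_ifs with h1 h2 h2
      · exact absurd (h1.trans h2.symm) hij
      · exact Finset.disjoint_singleton_right.2 (hj.resolve_left h2).2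
      · exact Finset.disjoint_singleton_left.2 (hi.resolve_left h1).2
      · rwa [Finset.disjoint_singleton]
    · intro j hj
      split_ifs with hjp
      · have := five_mul_card_sub_le hv (T := T) (S := T) (c := H) (B := B)
          (fun i hi j hj => hd i (hHI hi) j (hHI hj)) (fun j hj => hB j (hHI hj))
          fun j _ => Finset.inter_subset_right
        rw [hH4, hTsum] at this
        push_cast at this
        linarith
      · exact hgood j (Finset.mem_of_mem_insert_of_ne hj hjp)
  · have himg : H = T.image β := Finset.eq_of_subset_of_card_le hHβ
      (Finset.card_image_le.trans (hTcard.trans h5))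
    have hinj : Set.InjOn β T := Finset.card_image_iff.1
      (le_antisymm Finset.card_image_le (by rw [← himg]; omega))
    have hval : ∀ S ⊆ T, 5 * (S.card : ℝ) - ∑ g ∈ S, v g ≤
        ∑ i ∈ S.image β, ∑ g ∈ B i \ T, v g := by
      intro S hS
      have hSH : ∀ i ∈ S.image β, i ∈ I := fun i hi => by
        refine hHI ?_
        rw [himg]
        exact Finset.image_subset_image hS hi
      rw [← Finset.card_image_of_injOn (hinj.mono hS)]
      refine five_mul_card_sub_le hv (fun i hi j hj => hd i (hSH i hi) j (hSH j hj))
        (fun j hj => hB j (hSH j hj)) fun j hj g hg => ?_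
      obtain ⟨h1, h2⟩ := Finset.mem_inter.1 hg
      obtain ⟨s, hs, hsj⟩ := Finset.mem_image.1 hj
      rwa [hinj h2 (hS hs) ((hβ' j (hSH j hj) g h1).trans hsj.symm)]
    have hmT : ∀ S ⊆ T, S.image β ⊆ H := fun S hS => himg ▸ Finset.image_subset_image hS
    have hS1 : ({x, y} : Finset ℕ) ⊆ T := by grind
    have hS2 : ({a, b, z} : Finset ℕ) ⊆ T := by grind
    have hxT : x ∈ T := hS1 (by simp)
    have haT : a ∈ T := hS2 (by simp)
    have hxH : β x ∈ H := himg ▸ Finset.mem_image_of_mem β hxT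
    have haH : β a ∈ H := himg ▸ Finset.mem_image_of_mem β haT
    have hne : β x ≠ β a := fun h => hxa (hinj hxT haT h)
    have hdis : Disjoint (({x, y} : Finset ℕ).image β) (({a, b, z} : Finset ℕ).image β) := by
      rw [Finset.disjoint_left]
      intro j hj hj'
      obtain ⟨s, hs, rfl⟩ := Finset.mem_image.1 hj
      obtain ⟨t, ht, hts⟩ := Finset.mem_image.1 hj'
      have := hinj (hS2 ht) (hS1 hs) hts
      subst this
      simp only [Finset.mem_insert, Finset.mem_singleton] at hs ht
      omega
    refine BundlesAvoiding.merge (J := insert (β x) (insert (β a) (I \ H)))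
      (c := fun j => if j = β x then ({x, y} : Finset ℕ).image β else
        if j = β a then ({a, b, z} : Finset ℕ).image β else {j}) hd ?_ ?_ ?_ ?_
    · rw [Finset.card_insert_of_notMem, Finset.card_insert_of_notMem]
      · omega
      · simp [haH]
      · simp [hxH, hne]
    · intro j hj
      split_ifs with h1 h2
      · exact (hmT _ hS1).trans hHI
      · exact (hmT _ hS2).trans hHI
      · have := Finset.mem_of_mem_insert_of_ne (Finset.mem_of_mem_insert_of_ne hj h1) h2
        exact Finset.singleton_subset_iff.2 (Finset.mem_sdiff.1 this).1
    · intro i hi j hj hij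
      rw [Finset.mem_insert, Finset.mem_insert, Finset.mem_sdiff] at hi hj
      have k1 := fun t ht => hmT _ hS1 (x := t) ht
      have k2 := fun t ht => hmT _ hS2 (x := t) ht
      split_ifs with h1 h2 h3 h4 h5 h6 h7 h8
      · exact absurd (h1.trans h2.symm) hij
      · exact hdis
      · rw [Finset.disjoint_singleton_right]
        exact fun h => ((hj.resolve_left h2).resolve_left h3).2 (k1 _ h)
      · exact hdis.symm
      · exact absurd (h4.trans h6.symm) hij
      · rw [Finset.disjoint_singleton_right]
        exact fun h => ((hj.resolve_left h5).resolve_left h6).2 (k2 _ h)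
      · rw [Finset.disjoint_singleton_left]
        exact fun h => ((hi.resolve_left h1).resolve_left h4).2 (k1 _ h)
      · rw [Finset.disjoint_singleton_left]
        exact fun h => ((hi.resolve_left h1).resolve_left h4).2 (k2 _ h)
      · rwa [Finset.disjoint_singleton]
    · intro j hj
      split_ifs with h1 h2
      · refine le_trans ?_ (hval _ hS1)
        rw [Finset.card_pair hxy, Finset.sum_pair hxy]
        push_cast
        linarith
      · refine le_trans ?_ (hval _ hS2)
        have h3 : a ∉ ({b, z} : Finset ℕ) := by simp [hab, haz]
        rw [Finset.card_insert_of_notMem h3, Finset.sum_insert h3, Finset.card_pair hbz,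
          Finset.sum_pair hbz]
        push_cast
        linarith
      · exact hgood j (Finset.mem_of_mem_insert_of_ne (Finset.mem_of_mem_insert_of_ne hj h1) h2)

/-- Bags of values `u j`, `j < n`, are filled one after the other with a queue of `F + κ` fillers
of values `f`, the last `κ` of which repeat the first ones. The fillers before `s` have been used,
the bags outside `Q` have been given away, those in `U` without any filler and the other ones with
a last filler recorded in `E`. If every bag given away was worth less than `4` before its last
filler, then the fillers left suffice for one more bag. -/
lemma four_le_bag_add_sum {u f : ℕ → ℝ} {n κ F s j : ℕ} {Q U E : Finset ℕ}
    (hκF : κ < F) (hnκ : n ≤ 3 * κ + 2) (hf0 : ∀ τ, 0 ≤ f τ) (hf : ∀ τ, f τ ≤ 4 / 3)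
    (hanti : ∀ a b, a ≤ b → b < F → f b ≤ f a) (hper : ∀ r < κ, f (F + r) = f r)
    (htot : 5 * (n : ℝ) ≤ ∑ b ∈ range n, u b + ∑ τ ∈ range F, f τ)
    (hJ : ((range n).filter fun b => 5 < u b).card ≤ 1) (hu : ∀ b < n, u b ≤ 6)
    (hs : s ≤ F + κ) (hQ : Q ⊆ range n) (hU : U ⊆ range n \ Q) (hE : E ⊆ range s)
    (hcard : E.card + U.card + Q.card = n)
    (hinv : ∑ b ∈ range n \ Q, u b + ∑ τ ∈ range s, f τ ≤ ∑ b ∈ U, u b + ∑ e ∈ E, (4 + f e))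
    (hj : j ∈ Q) : 4 ≤ u j + ∑ τ ∈ Ico s (min (F + κ) (s + F)), f τ := by
  have hexc : ∀ W ⊆ range n, ∑ b ∈ W, (u b - 5) ≤ 1 := by
    intro W hW
    calc ∑ b ∈ W, (u b - 5) ≤ ∑ b ∈ W, if 5 < u b then (1 : ℝ) else 0 := by
          refine Finset.sum_le_sum fun b hb => ?_
          have := hu b (Finset.mem_range.1 (hW hb))
          split_ifs <;> linarith
      _ ≤ ∑ b ∈ range n, if 5 < u b then (1 : ℝ) else 0 :=
          Finset.sum_le_sum_of_subset_of_nonneg hW fun b _ _ => by split_ifs <;> norm_num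
      _ = (((range n).filter fun b => 5 < u b).card : ℝ) := by
          rw [Finset.sum_boole]
      _ ≤ 1 := by exact_mod_cast hJ
  have hsub : ∀ W : Finset ℕ, ∑ b ∈ W, (u b - 5) = ∑ b ∈ W, u b - 5 * (W.card : ℝ) := by
    intro W
    rw [Finset.sum_sub_distrib, Finset.sum_const, nsmul_eq_mul, mul_comm]
  have hshift : ∀ r ≤ κ, ∑ τ ∈ range (F + r), f τ =
      ∑ τ ∈ range F, f τ + ∑ τ ∈ range r, f τ := by
    intro r hr
    rw [Finset.sum_range_add]
    congr 1
    exact Finset.sum_congr rfl fun τ hτ =>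
      hper τ ((Finset.mem_range.1 hτ).trans_le hr)
  by_contra! hlt
  rcases le_or_gt (s + F) (F + κ) with hsF | hsF
  · rw [min_eq_right hsF, Finset.sum_Ico_eq_sub _ (Nat.le_add_right s F), add_comm s F,
      hshift s (by omega)] at hlt
    have h1 := hexc (range n \ {j}) Finset.sdiff_subset
    have h2 := Finset.sum_sdiff_eq_sub (f := u) (Finset.singleton_subset_iff.2 (hQ hj))
    rw [hsub, h2, Finset.sum_singleton, Finset.card_sdiff_of_subset
      (Finset.singleton_subset_iff.2 (hQ hj)), Finset.card_range, Finset.card_singleton,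
      Nat.cast_sub (by have := Finset.mem_range.1 (hQ hj); omega)] at h1
    push_cast at h1
    linarith
  · rw [min_eq_left hsF.le, Finset.sum_Ico_eq_sub _ hs, hshift κ le_rfl] at hlt
    have hUQ : Disjoint U (Q.erase j) := by
      rw [Finset.disjoint_left]
      exact fun b hb hb' => (Finset.mem_sdiff.1 (hU hb)).2 (Finset.mem_of_mem_erase hb')
    set W := U ∪ Q.erase j with hW
    have hWn : W ⊆ range n := Finset.union_subset (hU.trans Finset.sdiff_subset)
      ((Finset.erase_subset _ _).trans hQ)
    have hWcard : W.card + E.card + 1 = n := by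
      rw [hW, Finset.card_union_of_disjoint hUQ, Finset.card_erase_of_mem hj]
      have := Finset.card_pos.2 ⟨j, hj⟩
      omega
    have hWsum : ∑ b ∈ W, u b = ∑ b ∈ U, u b + (∑ b ∈ Q, u b - u j) := by
      rw [hW, Finset.sum_union hUQ, Finset.sum_erase_eq_sub hj]
    have hQsum := Finset.sum_sdiff (f := u) hQ
    have hEsum : ∑ e ∈ E, (4 + f e) = ∑ e ∈ E, (f e - 1) + 5 * (E.card : ℝ) := by
      rw [← nsmul_eq_mul', ← Finset.sum_const, ← Finset.sum_add_distrib]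
      exact Finset.sum_congr rfl fun e _ => by ring
    have hWs := hsub W
    have hn : (n : ℝ) = W.card + E.card + 1 := by exact_mod_cast hWcard.symm
    have hkey : ∑ τ ∈ range κ, f τ + 1 < ∑ b ∈ W, (u b - 5) + ∑ e ∈ E, (f e - 1) := by
      linarith
    have hcase : (∑ b ∈ W, (u b - 5) ≤ 1 ∧ E.card ≤ 3 * κ) ∨
        (∑ b ∈ W, (u b - 5) = 0 ∧ E.card ≤ 3 * κ + 1) := by
      rcases W.eq_empty_or_nonempty with h | h
      · right
        rw [h, Finset.sum_empty]
        exact ⟨rfl, by omega⟩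
      · left
        have := Finset.card_pos.2 h
        exact ⟨hexc W hWn, by omega⟩
    rcases le_or_gt (f κ) 1 with hφ | hφ
    · have h1 : ∑ e ∈ E, (f e - 1) ≤ ∑ τ ∈ range κ, f τ := by
        have h2 : ∑ τ ∈ range F, max (f τ - 1) 0 = ∑ τ ∈ range κ, max (f τ - 1) 0 := by
          symm
          refine Finset.sum_subset (Finset.range_subset_range.2 hκF.le) fun τ h3 h4 => ?_
          have := hanti κ τ (by simpa using h4) (Finset.mem_range.1 h3)
          exact max_eq_right (by linarith)
        calc ∑ e ∈ E, (f e - 1) ≤ ∑ e ∈ E, max (f e - 1) 0 :=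
              Finset.sum_le_sum fun e _ => le_max_left _ _
          _ ≤ ∑ e ∈ range (F + κ), max (f e - 1) 0 :=
              Finset.sum_le_sum_of_subset_of_nonneg
                (hE.trans (Finset.range_subset_range.2 hs)) fun e _ _ => le_max_right _ _
          _ = ∑ τ ∈ range κ, max (f τ - 1) 0 + ∑ τ ∈ range κ, max (f τ - 1) 0 := by
              rw [Finset.sum_range_add, h2]
              congr 1
              exact Finset.sum_congr rfl fun τ hτ => by rw [hper τ (Finset.mem_range.1 hτ)]
          _ ≤ ∑ τ ∈ range κ, f τ := by
              rw [← Finset.sum_add_distrib]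
              refine Finset.sum_le_sum fun τ _ => ?_
              have := hf0 τ
              have := hf τ
              rcases max_cases (f τ - 1) 0 with h | h <;> linarith
      rcases hcase with h | h <;> linarith
    · have h1 : (κ : ℝ) ≤ ∑ τ ∈ range κ, f τ := by
        have := Finset.card_nsmul_le_sum (range κ) f 1 fun τ hτ =>
          hφ.le.trans (hanti τ κ (Finset.mem_range.1 hτ).le hκF)
        simpa using this
      have h2 : ∑ e ∈ E, (f e - 1) ≤ E.card * (1 / 3) := by
        have := Finset.sum_le_card_nsmul E (fun e => f e - 1) (1 / 3) fun e _ => by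
          have := hf e
          linarith
        rwa [nsmul_eq_mul] at this
      rcases hcase with ⟨h3, h4⟩ | ⟨h3, h4⟩
      · have : (E.card : ℝ) ≤ 3 * κ := by exact_mod_cast h4
        linarith
      · have : (E.card : ℝ) ≤ 3 * κ + 1 := by exact_mod_cast h4
        linarith

/-- As long as the fillers left suffice for one more bag, all bags can be filled, each with
consecutive fillers of the queue. -/
lemma exists_filling {ι : Type*} [DecidableEq ι] {u f : ι → ℕ → ℝ} {n F N : ℕ} {𝒮 : Finset ι}
    (hstep : ∀ i ∈ 𝒮, ∀ (s j : ℕ) (Q U E : Finset ℕ), s ≤ N → Q ⊆ range n → U ⊆ range n \ Q →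
      E ⊆ range s → E.card + U.card + Q.card = n →
      ∑ b ∈ range n \ Q, u i b + ∑ τ ∈ range s, f i τ ≤
        ∑ b ∈ U, u i b + ∑ e ∈ E, (4 + f i e) →
      j ∈ Q → 4 ≤ u i j + ∑ τ ∈ Ico s (min N (s + F)), f i τ)
    (R : Finset ι) (s : ℕ) (Q U E : Finset ℕ) (hR : R ⊆ 𝒮) (hRQ : R.card = Q.card) (hs : s ≤ N)
    (hQ : Q ⊆ range n) (hU : U ⊆ range n \ Q) (hE : E ⊆ range s)
    (hcard : E.card + U.card + Q.card = n)
    (hinv : ∀ i ∈ R, ∑ b ∈ range n \ Q, u i b + ∑ τ ∈ range s, f i τ ≤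
      ∑ b ∈ U, u i b + ∑ e ∈ E, (4 + f i e)) :
    ∃ b lo hi : ι → ℕ, (∀ i ∈ R, b i ∈ Q) ∧ Set.InjOn b R ∧
      (∀ i ∈ R, s ≤ lo i ∧ hi i ≤ N ∧ hi i ≤ lo i + F ∧
        4 ≤ u i (b i) + ∑ τ ∈ Ico (lo i) (hi i), f i τ) ∧
      ∀ i ∈ R, ∀ j ∈ R, i ≠ j → Disjoint (Ico (lo i) (hi i)) (Ico (lo j) (hi j)) := by
  induction R using Finset.strongInduction generalizing s Q U E with
  | H R ih =>
  rcases R.eq_empty_or_nonempty with rfl | ⟨i₁, hi₁⟩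
  · exact ⟨0, 0, 0, by simp⟩
  obtain ⟨j, hj⟩ : Q.Nonempty := Finset.card_pos.1 (hRQ ▸ Finset.card_pos.2 ⟨i₁, hi₁⟩)
  have hex : ∃ t, s ≤ t ∧ ∃ i ∈ R, 4 ≤ u i j + ∑ τ ∈ Ico s t, f i τ :=
    ⟨min N (s + F), by omega, i₁, hi₁,
      hstep i₁ (hR hi₁) s j Q U E hs hQ hU hE hcard (hinv i₁ hi₁) hj⟩
  classical
  let t := Nat.find hex
  obtain ⟨hst, i₀, hi₀, hval⟩ : s ≤ t ∧ ∃ i ∈ R, 4 ≤ u i j + ∑ τ ∈ Ico s t, f i τ :=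
    Nat.find_spec hex
  have htle : t ≤ min N (s + F) := Nat.find_min' hex ⟨by omega, i₁, hi₁,
      hstep i₁ (hR hi₁) s j Q U E hs hQ hU hE hcard (hinv i₁ hi₁) hj⟩
  have htmin : ∀ t' < t, s ≤ t' → ∀ i ∈ R, u i j + ∑ τ ∈ Ico s t', f i τ < 4 := by
    intro t' ht' hs' i hi
    by_contra! h
    exact Nat.find_min hex ht' ⟨hs', i, hi, h⟩
  have hjn : j ∈ range n := hQ hj
  have hsd : range n \ Q.erase j = insert j (range n \ Q) := by
    rw [Finset.sdiff_erase hjn]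
  have hjU : j ∉ range n \ Q := fun h => (Finset.mem_sdiff.1 h).2 hj
  have hQcard : (Q.erase j).card + 1 = Q.card := Finset.card_erase_add_one hj
  have hRcard : (R.erase i₀).card + 1 = R.card := Finset.card_erase_add_one hi₀
  have hss : R.erase i₀ ⊂ R := Finset.erase_ssubset hi₀
  obtain ⟨U', E', hU', hE', hcard', hinv'⟩ : ∃ U' E' : Finset ℕ,
      U' ⊆ range n \ Q.erase j ∧ E' ⊆ range t ∧ E'.card + U'.card + (Q.erase j).card = n ∧
      ∀ i ∈ R.erase i₀, ∑ b ∈ range n \ Q.erase j, u i b + ∑ τ ∈ range t, f i τ ≤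
        ∑ b ∈ U', u i b + ∑ e ∈ E', (4 + f i e) := by
    rw [hsd]
    rcases hst.eq_or_lt with hst' | hst'
    · refine ⟨insert j U, E, Finset.insert_subset_insert j hU, hst' ▸ hE, ?_, fun i hi => ?_⟩
      · rw [Finset.card_insert_of_notMem fun h => hjU (hU h)]
        omega
      · rw [Finset.sum_insert hjU, Finset.sum_insert fun h => hjU (hU h), ← hst']
        have := hinv i (Finset.mem_of_mem_erase hi)
        linarith
    · have ht : t - 1 ∉ E := fun h => by
        have := Finset.mem_range.1 (hE h)
        omega
      refine ⟨U, insert (t - 1) E, hU.trans (Finset.subset_insert _ _), ?_, ?_, fun i hi => ?_⟩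
      · refine Finset.insert_subset (Finset.mem_range.2 (by omega))
          (hE.trans (Finset.range_subset_range.2 hst))
      · rw [Finset.card_insert_of_notMem ht]
        omega
      · rw [Finset.sum_insert hjU, Finset.sum_insert ht]
        have h1 := hinv i (Finset.mem_of_mem_erase hi)
        have h2 := htmin (t - 1) (by omega) (by omega) i (Finset.mem_of_mem_erase hi)
        rw [Finset.sum_Ico_eq_sub _ (by omega)] at h2
        have h3 := Finset.sum_range_succ (f i) (t - 1)
        rw [Nat.sub_add_cancel (by omega)] at h3
        linarith
  obtain ⟨b, lo, hi, hbQ, hbinj, hlh, hdis⟩ := ih (R.erase i₀) hss t (Q.erase j) U' E'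
    (hss.subset.trans hR) (by omega) (htle.trans (min_le_left _ _))
    ((Finset.erase_subset _ _).trans hQ) hU' hE' hcard' hinv'
  have hmem : ∀ i ∈ R, i ≠ i₀ → i ∈ R.erase i₀ := fun i hi hne => Finset.mem_erase.2 ⟨hne, hi⟩
  have hdis₀ : ∀ i ∈ R, i ≠ i₀ → Disjoint (Ico s t) (Ico (lo i) (hi i)) := by
    intro i hi hne
    have := (hlh i (hmem i hi hne)).1
    rw [Finset.disjoint_left]
    intro τ h1 h2
    rw [Finset.mem_Ico] at h1 h2
    omega
  refine ⟨Function.update b i₀ j, Function.update lo i₀ s, Function.update hi i₀ t,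
    fun i hi => ?_, fun i hi i' hi' hii => ?_, fun i hi => ?_, fun i hi i' hi' hne => ?_⟩
  · by_cases h : i = i₀
    · subst h
      simpa using hj
    · rw [Function.update_of_ne h]
      exact Finset.mem_of_mem_erase (hbQ i (hmem i hi h))
  · by_cases h : i = i₀ <;> by_cases h' : i' = i₀
    · rw [h, h']
    · subst h
      rw [Function.update_self, Function.update_of_ne h'] at hii
      exact absurd hii.symm (Finset.ne_of_mem_erase (hbQ i' (hmem i' hi' h')))
    · subst h'
      rw [Function.update_self, Function.update_of_ne h] at hii
      exact absurd hii (Finset.ne_of_mem_erase (hbQ i (hmem i hi h)))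
    · rw [Function.update_of_ne h, Function.update_of_ne h'] at hii
      exact hbinj (hmem i hi h) (hmem i' hi' h') hii
  · by_cases h : i = i₀
    · subst h
      simp only [Function.update_self]
      exact ⟨le_rfl, htle.trans (min_le_left _ _), htle.trans (min_le_right _ _), hval⟩
    · simp only [Function.update_of_ne h]
      obtain ⟨h1, h2⟩ := hlh i (hmem i hi h)
      exact ⟨hst.trans h1, h2⟩
  · by_cases h : i = i₀ <;> by_cases h' : i' = i₀
    · exact absurd (h.trans h'.symm) hne
    · subst h
      simp only [Function.update_self, Function.update_of_ne h']
      exact hdis₀ i' hi' h'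
    · subst h'
      simp only [Function.update_self, Function.update_of_ne h]
      exact (hdis₀ i hi h).symm
    · simp only [Function.update_of_ne h, Function.update_of_ne h']
      have hi₂ := hmem i' hi' h'
      exact hdis i (hmem i hi h) _ hi₂ hne

/-- Few enough sets that are large enough have distinct representatives. -/
lemma exists_injOn_forall_mem {ι : Type*} [DecidableEq ι] {c : ℕ} {J : ι → Finset ℕ}
    (S : Finset ι) (hS : S.card ≤ c) (hJ : ∀ i ∈ S, c ≤ (J i).card) :
    ∃ b : ι → ℕ, Set.InjOn b S ∧ ∀ i ∈ S, b i ∈ J i := by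
  induction S using Finset.induction_on with
  | empty => exact ⟨0, by simp⟩
  | insert a S ha ih =>
    rw [Finset.card_insert_of_notMem ha] at hS
    obtain ⟨b, hb, hbJ⟩ := ih (by omega) fun i hi => hJ i (Finset.mem_insert_of_mem hi)
    obtain ⟨x, hx, hxb⟩ : ∃ x ∈ J a, x ∉ S.image b := by
      refine Finset.exists_mem_notMem_of_card_lt_card ?_
      have := hJ a (Finset.mem_insert_self a S)
      have := Finset.card_image_le (s := S) (f := b)
      omega
    have hne : ∀ i ∈ S, i ≠ a := fun i hi h => ha (h ▸ hi)
    refine ⟨Function.update b a x, fun i hi i' hi' hii => ?_, fun i hi => ?_⟩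
    · rw [Finset.mem_coe, Finset.mem_insert] at hi hi'
      rcases hi with rfl | hi <;> rcases hi' with rfl | hi'
      · rfl
      · rw [Function.update_self, Function.update_of_ne (hne i' hi')] at hii
        exact absurd (hii ▸ Finset.mem_image_of_mem b hi') hxb
      · rw [Function.update_self, Function.update_of_ne (hne i hi)] at hii
        exact absurd (hii ▸ Finset.mem_image_of_mem b hi) hxb
      · rw [Function.update_of_ne (hne i hi), Function.update_of_ne (hne i' hi')] at hii
        exact hb hi hi' hii
    · rcases Finset.mem_insert.1 hi with rfl | hi
      · rwa [Function.update_self]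
      · rw [Function.update_of_ne (hne i hi)]
        exact hbJ i hi

/-- Filled bags form a solution whose shared goods are the first `κ` fillers. -/
lemma exists_isSolution_of_filling {ι : Type*} [DecidableEq ι] {𝒜 : Finset ι} {v : ι → ℕ → ℝ}
    {n F κ k : ℕ} {b lo hi : ι → ℕ} (hκF : κ < F) (hκk : κ ≤ k) (hκn : κ ≤ n) (hn : 0 < n)
    (hb : ∀ i ∈ 𝒜, b i < n) (hinj : Set.InjOn b 𝒜)
    (hlh : ∀ i ∈ 𝒜, hi i ≤ F + κ ∧ hi i ≤ lo i + F ∧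
      4 ≤ v i (b i) + v i (2 * n - 1 - b i) + ∑ τ ∈ Ico (lo i) (hi i), v i (2 * n + τ % F))
    (hdis : ∀ i ∈ 𝒜, ∀ j ∈ 𝒜, i ≠ j → Disjoint (Ico (lo i) (hi i)) (Ico (lo j) (hi j))) :
    ∃ A D, IsSolution 𝒜 v k A D := by
  set P : ι → Finset ℕ := fun i => {b i, 2 * n - 1 - b i} with hP
  set S : ι → Finset ℕ := fun i => (Ico (lo i) (hi i)).image fun τ => 2 * n + τ % F with hS
  have hPlt : ∀ i ∈ 𝒜, ∀ g ∈ P i, g < 2 * n := by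
    intro i hi g hg
    have := hb i hi
    rw [hP, Finset.mem_insert, Finset.mem_singleton] at hg
    omega
  have hSge : ∀ i, ∀ g ∈ S i, 2 * n ≤ g := by
    intro i g hg
    obtain ⟨τ, -, rfl⟩ := Finset.mem_image.1 hg
    omega
  have hPb : ∀ i ∈ 𝒜, ∀ g ∈ P i, b i = min g (2 * n - 1 - g) := by
    intro i hi g hg
    have := hb i hi
    rw [hP, Finset.mem_insert, Finset.mem_singleton] at hg
    omega
  have hSmem : ∀ i ∈ 𝒜, ∀ r, 2 * n + r ∈ S i →
      r ∈ Ico (lo i) (hi i) ∨ (r < κ ∧ F + r ∈ Ico (lo i) (hi i)) := by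
    intro i hi r hr
    obtain ⟨τ, hτ, hτr⟩ := Finset.mem_image.1 hr
    have h1 := (hlh i hi).1
    have h2 := (Finset.mem_Ico.1 hτ).2
    rcases Nat.lt_or_ge τ F with h | h
    · rw [Nat.mod_eq_of_lt h] at hτr
      exact Or.inl (by rwa [← Nat.add_left_cancel hτr])
    · rw [Nat.mod_eq_sub_mod h, Nat.mod_eq_of_lt (by omega)] at hτr
      have h3 : τ = F + r := by omega
      exact Or.inr ⟨by omega, h3 ▸ hτ⟩
  have htok : ∀ r, (𝒜.filter fun i => r ∈ Ico (lo i) (hi i)).card ≤ 1 := by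
    intro r
    refine Finset.card_le_one.2 fun i h1 j h2 => ?_
    obtain ⟨h1, h3⟩ := Finset.mem_filter.1 h1
    obtain ⟨h2, h4⟩ := Finset.mem_filter.1 h2
    by_contra hij
    exact Finset.disjoint_left.1 (hdis i h1 j h2 hij) h3 h4
  have hsmall : ∀ g < 2 * n, (𝒜.filter fun i => g ∈ P i ∪ S i).card ≤ 1 := by
    intro g hg
    refine Finset.card_le_one.2 fun i h1 j h2 => ?_
    obtain ⟨h1, h3⟩ := Finset.mem_filter.1 h1
    obtain ⟨h2, h4⟩ := Finset.mem_filter.1 h2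
    have h5 : ∀ i, g ∈ P i ∪ S i → g ∈ P i := fun i h => (Finset.mem_union.1 h).resolve_right
      fun h => absurd (hSge i g h) (by omega)
    exact hinj h1 h2 ((hPb i h1 g (h5 i h3)).trans (hPb j h2 g (h5 j h4)).symm)
  have hlarge : ∀ r, ∀ i ∈ 𝒜, 2 * n + r ∈ P i ∪ S i → 2 * n + r ∈ S i := by
    intro r i hi h
    exact (Finset.mem_union.1 h).resolve_left fun h => absurd (hPlt i hi _ h) (by omega)
  refine ⟨fun i => P i ∪ S i, Ico (2 * n) (2 * n + κ), ⟨?_, ?_, ?_, ?_, ?_⟩⟩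
  · intro i hi
    obtain ⟨h1, h2, h3⟩ := hlh i hi
    rw [Finset.sum_union, hP, hS, Finset.sum_pair, Finset.sum_image]
    · exact h3
    · intro τ h4 τ' h5 hττ
      rw [Finset.mem_coe, Finset.mem_Ico] at h4 h5
      have h6 : τ % F = τ' % F := Nat.add_left_cancel hττ
      exact Nat.ModEq.eq_of_abs_lt (m := F) h6 (by rw [abs_lt]; omega)
    · have := hb i hi
      omega
    · rw [Finset.disjoint_left]
      exact fun g h4 h5 => absurd (hPlt i hi g h4) (by have := hSge i g h5; omega)
  · simpa using hκk
  · intro g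
    rcases Nat.lt_or_ge g (2 * n) with hg | hg
    · exact (hsmall g hg).trans (by norm_num)
    · obtain ⟨r, rfl⟩ := Nat.exists_eq_add_of_le hg
      have : (𝒜.filter fun i => 2 * n + r ∈ P i ∪ S i) ⊆
          (𝒜.filter fun i => r ∈ Ico (lo i) (hi i)) ∪
            𝒜.filter fun i => F + r ∈ Ico (lo i) (hi i) := by
        intro i hi
        obtain ⟨h1, h2⟩ := Finset.mem_filter.1 hi
        rw [Finset.mem_union, Finset.mem_filter, Finset.mem_filter]
        rcases hSmem i h1 r (hlarge r i h1 h2) with h | h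
        · exact Or.inl ⟨h1, h⟩
        · exact Or.inr ⟨h1, h.2⟩
      have h1 := (Finset.card_le_card this).trans (Finset.card_union_le _ _)
      have := htok r
      have := htok (F + r)
      omega
  · intro g hgD
    rcases Nat.lt_or_ge g (2 * n) with hg | hg
    · exact hsmall g hg
    · obtain ⟨r, rfl⟩ := Nat.exists_eq_add_of_le hg
      refine (Finset.card_le_card fun i hi => ?_).trans (htok r)
      obtain ⟨h1, h2⟩ := Finset.mem_filter.1 hi
      refine Finset.mem_filter.2 ⟨h1, (hSmem i h1 r (hlarge r i h1 h2)).resolve_right fun h => ?_⟩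
      exact hgD (Finset.mem_Ico.2 ⟨hg, by omega⟩)
  · intro i hi d hd
    have h1 : 2 * n ≤ d := (Finset.mem_Ico.1 (Finset.mem_inter.1 hd).2).1
    have h2 : ((P i ∪ S i) ∩ Ico (2 * n) (2 * n + κ)).card ≤ κ := by
      refine (Finset.card_le_card Finset.inter_subset_right).trans ?_
      simp
    have h3 : range (2 * n) \ P i ⊆
        (range d).filter fun g => g ∉ P i ∪ S i ∧ g ∉ Ico (2 * n) (2 * n + κ) := by
      intro g hg
      obtain ⟨h4, h5⟩ := Finset.mem_sdiff.1 hg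
      rw [Finset.mem_range] at h4
      refine Finset.mem_filter.2 ⟨Finset.mem_range.2 (by omega), fun h => ?_, fun h => ?_⟩
      · rcases Finset.mem_union.1 h with h | h
        · exact h5 h
        · exact absurd (hSge i g h) (by omega)
      · exact absurd (Finset.mem_Ico.1 h).1 (by omega)
    have h4 := Finset.card_le_card h3
    have h5 := Finset.le_card_sdiff (P i) (range (2 * n))
    have h6 : (P i).card ≤ 2 := Finset.card_le_two
    rw [Finset.card_range] at h5
    omega

/-- If every good is worth less than `4`, the goods from rank `n` on less than `2`, those from
rank `2 n` on less than `4 / 3`, and at most two agents have two pairs of goods of value above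
`5`, then all agents can be served by filling bags. -/
lemma exists_isSolution_of_card_le_two {ι : Type*} [DecidableEq ι] {𝒜 : Finset ι}
    {v : ι → ℕ → ℝ} {n k : ℕ} (hcard : 𝒜.card = n) (hn : 0 < n) (hnk : n ≤ 3 * k + 2)
    (hv : ∀ i, Antitone (v i)) (hv0 : ∀ i g, 0 ≤ v i g)
    (hB : ∀ i ∈ 𝒜, BundlesAvoiding (v i) ∅ n) (h4 : ∀ i ∈ 𝒜, v i 0 < 4)
    (h2 : ∀ i ∈ 𝒜, v i n < 2) (h43 : ∀ i ∈ 𝒜, v i (2 * n) < 4 / 3)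
    (hJ : (𝒜.filter fun i =>
      2 ≤ ((range n).filter fun j => 5 < v i j + v i (2 * n - 1 - j)).card).card ≤ 2) :
    ∃ A D, IsSolution 𝒜 v k A D := by
  choose! M hM using fun i (hi : i ∈ 𝒜) => (hB i hi).exists_le_sum_range (hv0 i)
  set κ := min k n with hκ
  set F := 𝒜.sup M + κ + 1 with hF
  set u : ι → ℕ → ℝ := fun i j => v i j + v i (2 * n - 1 - j) with hu
  set f : ι → ℕ → ℝ := fun i τ => v i (2 * n + τ % F) with hf
  set S := 𝒜.filter fun i => 2 ≤ ((range n).filter fun j => 5 < u i j).card with hS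
  have hSA : S ⊆ 𝒜 := Finset.filter_subset _ _
  obtain ⟨b₁, hb₁, hb₁J⟩ := exists_injOn_forall_mem
    (J := fun i => (range n).filter fun j => 5 < u i j) S hJ fun i hi => (Finset.mem_filter.1 hi).2
  have hpairs : ∀ i, ∑ j ∈ range n, u i j = ∑ g ∈ range (2 * n), v i g := by
    intro i
    rw [two_mul n, Finset.sum_range_add, hu, Finset.sum_add_distrib]
    congr 1
    rw [← Finset.sum_range_reflect]
    refine Finset.sum_congr rfl fun j hj => ?_
    have := Finset.mem_range.1 hj
    congr 1
    omega
  have himg : S.image b₁ ⊆ range n := fun j hj => by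
    obtain ⟨i, hi, rfl⟩ := Finset.mem_image.1 hj
    exact (Finset.mem_filter.1 (hb₁J i hi)).1
  have hScard : (S.image b₁).card = S.card := Finset.card_image_of_injOn hb₁
  have hsdcard : (𝒜 \ S).card + S.card = n := by
    rw [Finset.card_sdiff_add_card_eq_card hSA, hcard]
  have hQcard : (range n \ S.image b₁).card + S.card = n := by
    rw [← hScard, Finset.card_sdiff_add_card_eq_card himg, Finset.card_range]
  obtain ⟨b₂, lo, hi, hb₂, hb₂inj, hlh, hdis⟩ := exists_filling (u := u) (f := f) (n := n)
    (F := F) (N := F + κ) (𝒮 := 𝒜 \ S) (by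
      intro i hi s j Q U E hs hQ hU hE hc hinv hj
      obtain ⟨hiA, hiS⟩ := Finset.mem_sdiff.1 hi
      refine four_le_bag_add_sum (n := n) (κ := κ) (by omega) (by omega) (fun τ => hv0 i _)
        (fun τ => ((hv i (Nat.le_add_right _ _)).trans (h43 i hiA).le)) ?_ ?_ ?_ ?_ ?_
        hs hQ hU hE hc hinv hj
      · intro a b hab hbF
        simp only [hf]
        rw [Nat.mod_eq_of_lt hbF, Nat.mod_eq_of_lt (hab.trans_lt hbF)]
        exact hv i (by omega)
      · intro r _
        simp only [hf, Nat.add_mod_left]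
      · have h5 : ∑ τ ∈ range F, f i τ = ∑ τ ∈ range F, v i (2 * n + τ) :=
          Finset.sum_congr rfl fun τ hτ => by
            simp only [hf, Nat.mod_eq_of_lt (Finset.mem_range.1 hτ)]
        rw [hpairs, h5, ← Finset.sum_range_add]
        have : M i ≤ 𝒜.sup M := Finset.le_sup hiA
        exact hM i hiA _ (by omega)
      · by_contra! h
        exact hiS (Finset.mem_filter.2 ⟨hiA, h⟩)
      · intro b hb
        have h5 := (hv i (Nat.zero_le b)).trans_lt (h4 i hiA)
        have h6 := (hv i (show n ≤ 2 * n - 1 - b by omega)).trans_lt (h2 i hiA)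
        simp only [hu]
        linarith)
    (𝒜 \ S) 0 (range n \ S.image b₁) (S.image b₁) ∅ Finset.Subset.rfl (by omega) (by omega)
    Finset.sdiff_subset (by rw [Finset.sdiff_sdiff_eq_self himg]) (Finset.empty_subset _)
    (by rw [Finset.card_empty]; omega)
    (fun i _ => by simp [Finset.sdiff_sdiff_eq_self himg])
  have hmem : ∀ i ∈ 𝒜, i ∉ S → i ∈ 𝒜 \ S := fun i h h' => Finset.mem_sdiff.2 ⟨h, h'⟩
  refine exists_isSolution_of_filling (n := n) (F := F) (κ := κ)
    (b := fun i => if i ∈ S then b₁ i else b₂ i) (lo := fun i => if i ∈ S then 0 else lo i)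
    (hi := fun i => if i ∈ S then 0 else hi i) (by omega) (by omega) (by omega) hn ?_ ?_ ?_ ?_
  · intro i hi
    by_cases h : i ∈ S
    · simpa only [if_pos h] using Finset.mem_range.1 (himg (Finset.mem_image_of_mem b₁ h))
    · simpa only [if_neg h] using
        Finset.mem_range.1 (Finset.mem_sdiff.1 (hb₂ i (hmem i hi h))).1
  · intro i hi j hj hij
    have hne : ∀ i ∈ S, ∀ j ∈ 𝒜, j ∉ S → b₁ i ≠ b₂ j := fun i h j h' h'' hij =>
      (Finset.mem_sdiff.1 (hb₂ j (hmem j h' h''))).2 (hij ▸ Finset.mem_image_of_mem b₁ h)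
    by_cases h : i ∈ S <;> by_cases h' : j ∈ S
    · simp only [if_pos h, if_pos h'] at hij
      exact hb₁ h h' hij
    · simp only [if_pos h, if_neg h'] at hij
      exact absurd hij (hne i h j hj h')
    · simp only [if_neg h, if_pos h'] at hij
      exact absurd hij.symm (hne j h' i hi h)
    · simp only [if_neg h, if_neg h'] at hij
      exact hb₂inj (hmem i hi h) (hmem j hj h') hij
  · intro i hi
    by_cases h : i ∈ S
    · simp only [if_pos h]
      refine ⟨by omega, by omega, ?_⟩
      have h5 : 5 < u i (b₁ i) := (Finset.mem_filter.1 (hb₁J i h)).2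
      simp only [hu] at h5
      simp only [Finset.Ico_self, Finset.sum_empty]
      linarith
    · simp only [if_neg h]
      exact (hlh i (hmem i hi h)).2
  · intro i hi j hj hij
    by_cases h : i ∈ S
    · simp only [if_pos h, Finset.Ico_self, Finset.disjoint_empty_left]
    by_cases h' : j ∈ S
    · simp only [if_pos h', Finset.Ico_self, Finset.disjoint_empty_right]
    · simp only [if_neg h, if_neg h']
      exact hdis i (hmem i hi h) j (hmem j hj h') hij

lemma three_lt_and_one_lt {v : ℕ → ℝ} (hv : Antitone v) {q : ℕ} (h0 : v 0 < 4)
    (h2 : v (q + 3) < 2) (h4 : v (q + 2) + v (q + 3) < 4)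
    (hJ : 2 ≤ ((range (q + 3)).filter fun j => 5 < v j + v (2 * (q + 3) - 1 - j)).card) :
    3 < v 1 ∧ 1 < v (q + 5) := by
  have hlt : ∀ j < q + 3, 5 < v j + v (2 * (q + 3) - 1 - j) → j < q + 2 := by
    intro j hj h
    by_contra! hj'
    obtain rfl : j = q + 2 := by omega
    rw [show 2 * (q + 3) - 1 - (q + 2) = q + 3 by omega] at h
    linarith
  have key : ∀ j₁ j₂, j₁ < j₂ → j₂ < q + 2 → 5 < v j₁ + v (2 * (q + 3) - 1 - j₁) →
      5 < v j₂ + v (2 * (q + 3) - 1 - j₂) → 3 < v 1 ∧ 1 < v (q + 5) := by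
    intro j₁ j₂ h1 h3 h5 h6
    have h7 := hv (show 1 ≤ j₂ by omega)
    have h8 := hv (show q + 3 ≤ 2 * (q + 3) - 1 - j₂ by omega)
    have h9 := hv (show q + 5 ≤ 2 * (q + 3) - 1 - j₁ by omega)
    have h10 := hv (show 0 ≤ j₁ by omega)
    exact ⟨by linarith, by linarith⟩
  obtain ⟨a, ha, b, hb, hab⟩ := Finset.one_lt_card.1 hJ
  rw [Finset.mem_filter, Finset.mem_range] at ha hb
  rcases hab.lt_or_gt with h | h
  · exact key a b h (hlt b hb.1 hb.2) ha.2 hb.2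
  · exact key b a h (hlt a ha.1 ha.2) hb.2 ha.2

/-- Agents who can each form as many bundles of value `5` as there are agents can be given value
`4` each. -/
theorem exists_isSolution {ι : Type*} [DecidableEq ι] {𝒜 : Finset ι} {v : ι → ℕ → ℝ} {n k : ℕ}
    (hcard : 𝒜.card = n) (hnk : n ≤ 3 * k + 2) (hv : ∀ i, Antitone (v i))
    (hv0 : ∀ i g, 0 ≤ v i g) (hB : ∀ i ∈ 𝒜, BundlesAvoiding (v i) ∅ n) :
    ∃ A D, IsSolution 𝒜 v k A D := by
  induction n using Nat.strong_induction_on generalizing 𝒜 v k with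
  | _ n ih =>
  rcases n with _ | m
  · obtain rfl := Finset.card_eq_zero.1 hcard
    exact ⟨fun _ => ∅, ∅, by constructor <;> simp⟩
  have hcomp : ∀ (T : Finset ℕ) i, Antitone (v i ∘ survivors T) := fun T i =>
    (hv i).comp_monotone (survivors T).monotone
  by_cases hred : ∃ t, ∃ i ∈ 𝒜, 4 ≤ ∑ g ∈ Icc (t * m) (t * m + t), v i g
  · obtain ⟨t, p, hp, ht⟩ := hred
    obtain ⟨A, D, hs⟩ := ih m (by omega) (𝒜 := 𝒜 \ {p})
      (v := fun i => v i ∘ survivors (Icc (t * m) (t * m + t))) (k := k)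
      (by rw [Finset.card_sdiff_of_subset (by simpa using hp), hcard, Finset.card_singleton]
          omega)
      (by omega) (hcomp _) (fun i g => hv0 i _)
      fun i hi => ((hB i (Finset.mem_sdiff.1 hi).1).remove_pigeonhole (hv i) t).comp_survivors
    refine hs.extend (C := fun _ => Icc (t * m) (t * m + t)) (E := ∅)
      (fun _ _ => Finset.Subset.rfl) (Finset.empty_subset _)
      (fun i hi => by rwa [Finset.mem_singleton.1 hi])
      (fun g => (Finset.card_filter_le _ _).trans (by simp))
      (fun g _ => (Finset.card_filter_le _ _).trans (by simp)) (by simp) (by simp)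
  push Not at hred
  have h4 : ∀ i ∈ 𝒜, v i 0 < 4 := fun i hi => by simpa using hred 0 i hi
  have h24 : ∀ i ∈ 𝒜, v i m + v i (m + 1) < 4 := fun i hi => by
    have := hred 1 i hi
    rwa [one_mul, ← Finset.Ico_add_one_right_eq_Icc, Finset.sum_Ico_succ_top (by omega),
      Finset.sum_Ico_succ_top (by omega), Finset.Ico_self, Finset.sum_empty, zero_add] at this
  have h2 : ∀ i ∈ 𝒜, v i (m + 1) < 2 := fun i hi => by
    have := h24 i hi
    have := hv i (Nat.le_succ m)
    linarith
  have h43 : ∀ i ∈ 𝒜, v i (2 * (m + 1)) < 4 / 3 := fun i hi => by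
    have := hred 2 i hi
    rw [← Finset.Ico_add_one_right_eq_Icc, Finset.sum_Ico_succ_top (by omega),
      Finset.sum_Ico_succ_top (by omega), Finset.sum_Ico_succ_top (by omega), Finset.Ico_self,
      Finset.sum_empty, zero_add] at this
    have h5 := hv i (show 2 * m ≤ 2 * m + 2 by omega)
    have h6 := hv i (show 2 * m + 1 ≤ 2 * m + 2 by omega)
    rw [mul_add, mul_one]
    linarith
  rcases Nat.lt_or_ge 2 (𝒜.filter fun i => 2 ≤ ((range (m + 1)).filter fun j =>
    5 < v i j + v i (2 * (m + 1) - 1 - j)).card).card with hJ | hJ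
  swap
  · exact exists_isSolution_of_card_le_two hcard (by omega) hnk hv hv0 hB h4 h2 h43 hJ
  obtain ⟨q, rfl⟩ : ∃ q, m = q + 2 := by
    have := hJ.trans_le (Finset.card_filter_le _ _)
    exact ⟨m - 2, by omega⟩
  obtain ⟨p₁, hp₁, p₂, hp₂, p₃, hp₃, h12, h13, h23⟩ := Finset.two_lt_card.1 hJ
  rw [Finset.mem_filter] at hp₁ hp₂ hp₃
  have hsub : ({p₁, p₂, p₃} : Finset ι) ⊆ 𝒜 := by
    simp [Finset.insert_subset_iff, hp₁.1, hp₂.1, hp₃.1]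
  have hP3 : ({p₁, p₂, p₃} : Finset ι).card = 3 := Finset.card_eq_three.2
    ⟨p₁, p₂, p₃, h12, h13, h23, rfl⟩
  set T : Finset ℕ := {0, 1, q + 3, q + 4, q + 5} with hT
  obtain ⟨A, D, hs⟩ := ih q (by omega) (𝒜 := 𝒜 \ {p₁, p₂, p₃})
    (v := fun i => v i ∘ survivors T) (k := k - 1)
    (by rw [Finset.card_sdiff_of_subset hsub, hcard, hP3]; omega)
    (by omega) (hcomp _) (fun i g => hv0 i _)
    fun i hi => by
      have hi := (Finset.mem_sdiff.1 hi).1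
      have h5 : ∀ g, q + 3 ≤ g → v i g < 2 := fun g hg => (hv i hg).trans_lt (h2 i hi)
      have h6 : ∀ g, v i g < 4 := fun g => (hv i (Nat.zero_le g)).trans_lt (h4 i hi)
      exact (BundlesAvoiding.remove_five (hv0 i) (h6 0) (h6 1) (h5 (q + 3) (by omega))
        (h5 (q + 4) (by omega)) (h5 (q + 5) (by omega)) (by omega) (by omega) (by omega)
        (by omega) (by omega) (by omega) (by omega) (by omega) (by omega) (by omega)
        (hB i hi)).comp_survivors
  set C : ι → Finset ℕ := fun i => if i = p₁ then {0, q + 3} else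
    if i = p₂ then {0, q + 4} else {1, q + 5} with hC
  have hC₁ : C p₁ = {0, q + 3} := if_pos rfl
  have hC₂ : C p₂ = {0, q + 4} := by simp [hC, h12.symm]
  have hC₃ : C p₃ = {1, q + 5} := by simp [hC, h13.symm, h23.symm]
  have hone : ∀ g, g ∉ ({0} : Finset ℕ) →
      ((({p₁, p₂, p₃} : Finset ι)).filter fun i => g ∈ C i).card ≤ 1 := by
    intro g hg
    rw [Finset.mem_singleton] at hg
    refine Finset.card_le_one.2 fun i hi j hj => ?_
    simp only [Finset.mem_filter, Finset.mem_insert, Finset.mem_singleton] at hi hj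
    obtain ⟨rfl | rfl | rfl, hi⟩ := hi <;> obtain ⟨rfl | rfl | rfl, hj⟩ := hj <;>
      first
      | rfl
      | (simp only [hC₁, hC₂, hC₃, Finset.mem_insert, Finset.mem_singleton] at hi hj; omega)
  have hval : ∀ p ∈ 𝒜, 2 ≤ ((range (q + 2 + 1)).filter fun j =>
      5 < v p j + v p (2 * (q + 2 + 1) - 1 - j)).card →
      ∀ a b, a ≤ 1 → b ≤ q + 5 → 4 ≤ v p a + v p b := by
    intro p hp hpJ a b ha hb
    have := three_lt_and_one_lt (hv p) (h4 p hp) (h2 p hp) (h24 p hp) hpJ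
    have := hv p ha
    have := hv p hb
    linarith
  refine hs.extend (C := C) (E := {0}) ?_ (by simp [hT]) ?_ ?_ hone ?_ ?_
  · simp only [Finset.mem_insert, Finset.mem_singleton]
    rintro i (rfl | rfl | rfl)
    · rw [hC₁]; simp [hT, Finset.insert_subset_iff]
    · rw [hC₂]; simp [hT, Finset.insert_subset_iff]
    · rw [hC₃]; simp [hT, Finset.insert_subset_iff]
  · simp only [Finset.mem_insert, Finset.mem_singleton]
    rintro i (rfl | rfl | rfl)
    · rw [hC₁, Finset.sum_pair (by omega)]
      exact hval _ hp₁.1 hp₁.2 _ _ (by omega) (by omega)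
    · rw [hC₂, Finset.sum_pair (by omega)]
      exact hval _ hp₂.1 hp₂.2 _ _ (by omega) (by omega)
    · rw [hC₃, Finset.sum_pair (by omega)]
      exact hval _ hp₃.1 hp₃.2 _ _ (by omega) (by omega)
  · intro g
    by_cases hg : g = 0
    · subst hg
      refine (Finset.card_le_card (t := {p₁, p₂}) fun i hi => ?_).trans Finset.card_le_two
      simp only [Finset.mem_filter, Finset.mem_insert, Finset.mem_singleton] at hi ⊢
      obtain ⟨rfl | rfl | rfl, hi⟩ := hi
      · exact Or.inl rfl
      · exact Or.inr rfl
      · simp [hC₃] at hi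
    · exact (hone g (by simpa using hg)).trans (by norm_num)
  · exact fun i _ => (Finset.card_le_card Finset.inter_subset_right).trans (by simp)
  · rw [Finset.card_singleton]
    omega

/-- The condition `IsSolution.room` bounds the number of own goods plus shared goods among the
goods `0, …, j`. -/
lemma card_inter_add_card_inter_le {A D : Finset ℕ} {j : ℕ}
    (hroom : ∀ d ∈ A ∩ D, (A ∩ D).card ≤ 1 + ((range d).filter fun g => g ∉ A ∧ g ∉ D).card) :
    (A ∩ range (j + 1)).card + (D ∩ range (j + 1)).card ≤ j + 2 := by
  set R := range (j + 1) with hR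
  have h1 := Finset.card_union_add_card_inter (A ∩ R) (D ∩ R)
  have h2 : ((A ∩ R) ∪ (D ∩ R)).card + (R.filter fun g => g ∉ A ∧ g ∉ D).card ≤ j + 1 := by
    rw [← Finset.card_union_of_disjoint]
    · refine (Finset.card_le_card (t := R) fun g hg => ?_).trans (by simp [hR])
      simp only [Finset.mem_union, Finset.mem_inter, Finset.mem_filter] at hg
      tauto
    · rw [Finset.disjoint_left]
      intro g hg hg'
      simp only [Finset.mem_union, Finset.mem_inter, Finset.mem_filter] at hg hg'
      tauto
  rcases ((A ∩ R) ∩ (D ∩ R)).eq_empty_or_nonempty with h | ⟨d, hd⟩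
  · rw [h, Finset.card_empty] at h1
    omega
  · simp only [Finset.mem_inter] at hd
    have h3 := hroom d (Finset.mem_inter.2 ⟨hd.1.1, hd.2.1⟩)
    have h4 : ((A ∩ R) ∩ (D ∩ R)).card ≤ (A ∩ D).card := Finset.card_le_card
      (Finset.inter_subset_inter Finset.inter_subset_left Finset.inter_subset_left)
    have h5 : ((range d).filter fun g => g ∉ A ∧ g ∉ D).card ≤
        (R.filter fun g => g ∉ A ∧ g ∉ D).card :=
      Finset.card_le_card (Finset.filter_subset_filter _ (Finset.range_subset_range.2
        (Finset.mem_range.1 hd.1.2).le))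
    omega

/-- An agent `i` may be handed one more good, provided it has room for another owner. -/
lemma insert_good {ι G : Type*} [Fintype ι] [DecidableEq ι] [Fintype G] [DecidableEq G]
    {k : ℕ} {B : ι → Finset G} (h2 : ∀ g, (univ.filter fun i => g ∈ B i).card ≤ 2)
    (hk : (univ.filter fun g => (univ.filter fun i => g ∈ B i).card = 2).card ≤ k)
    {i : ι} {g : G}
    (hg : (univ.filter fun i => g ∈ B i).card = 0 ∨ (univ.filter fun i => g ∈ B i).card = 1 ∧
      (univ.filter fun g => (univ.filter fun i => g ∈ B i).card = 2).card < k) :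
    (∀ h, (univ.filter fun i' => h ∈ Function.update B i (insert g (B i)) i').card ≤ 2) ∧
    (univ.filter fun h =>
      (univ.filter fun i' => h ∈ Function.update B i (insert g (B i)) i').card = 2).card ≤ k := by
  set B' := Function.update B i (insert g (B i)) with hB'
  have hself : B' i = insert g (B i) := Function.update_self _ _ _
  have hother : ∀ i', i' ≠ i → B' i' = B i' := fun i' h => Function.update_of_ne h _ _
  have hne : ∀ h, h ≠ g → (univ.filter fun i' => h ∈ B' i') = univ.filter fun i' => h ∈ B i' := by
    intro h hh
    refine Finset.filter_congr fun i' _ => ?_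
    by_cases hi : i' = i
    · subst hi
      rw [hself, Finset.mem_insert, or_iff_right hh]
    · rw [hother i' hi]
  have hgg : (univ.filter fun i' => g ∈ B' i') ⊆ insert i (univ.filter fun i' => g ∈ B i') := by
    intro i' hi'
    rw [Finset.mem_insert, Finset.mem_filter]
    by_cases hi : i' = i
    · exact Or.inl hi
    · rw [Finset.mem_filter, hother i' hi] at hi'
      exact Or.inr hi'
  have hgc := (Finset.card_le_card hgg).trans (Finset.card_insert_le _ _)
  refine ⟨fun h => ?_, ?_⟩
  · by_cases hh : h = g
    · subst hh
      omega
    · rw [hne h hh]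
      exact h2 h
  · have h3 : (univ.filter fun h => (univ.filter fun i' => h ∈ B' i').card = 2) ⊆
        insert g (univ.filter fun h => (univ.filter fun i' => h ∈ B i').card = 2) := by
      intro h hh
      rw [Finset.mem_insert, Finset.mem_filter]
      by_cases hhg : h = g
      · exact Or.inl hhg
      · rw [Finset.mem_filter, hne h hhg] at hh
        exact Or.inr hh
    rcases hg with hg | ⟨-, hg⟩
    · refine (Finset.card_le_card fun h hh => ?_).trans hk
      refine (Finset.mem_insert.1 (h3 hh)).resolve_left fun hhg => ?_
      subst hhg
      have := (Finset.mem_filter.1 hh).2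
      omega
    · exact (Finset.card_le_card h3).trans ((Finset.card_insert_le _ _).trans hg)

/-- Agents ranking the goods differently can pick goods at least as good as those of a solution
for agents with a common ranking. -/
theorem exists_allocation_of_ranks {ι G : Type*} [Fintype ι] [DecidableEq ι] [Fintype G]
    [DecidableEq G] {m k : ℕ} {w : ι → G → ℝ} {σ : ι → ℕ → G}
    (hσ : ∀ i, Set.InjOn (σ i) (Set.Iio m))
    (hσw : ∀ i a b, a ≤ b → b < m → w i (σ i b) ≤ w i (σ i a))
    {A : ι → Finset ℕ} {D : Finset ℕ} (hD : D.card ≤ k)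
    (h2 : ∀ g, (univ.filter fun i => g ∈ A i).card ≤ 2)
    (h1 : ∀ g, g ∉ D → (univ.filter fun i => g ∈ A i).card ≤ 1)
    (hroom : ∀ i, ∀ d ∈ A i ∩ D,
      (A i ∩ D).card ≤ 1 + ((range d).filter fun g => g ∉ A i ∧ g ∉ D).card) :
    ∃ B : ι → Finset G,
      (∀ i, ∑ j ∈ A i ∩ range m, w i (σ i j) ≤ ∑ g ∈ B i, w i g) ∧
      (∀ g, (univ.filter fun i => g ∈ B i).card ≤ 2) ∧
      (univ.filter fun g => (univ.filter fun i => g ∈ B i).card = 2).card ≤ k := by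
  suffices key : ∀ X : Finset (ι × ℕ), (∀ x ∈ X, x.2 ∈ A x.1 ∧ x.2 < m) →
      ∃ B : ι → Finset G,
        (∀ i, (B i).card = (X.filter fun x => x.1 = i).card) ∧
        (∀ i, ∑ x ∈ X.filter fun x => x.1 = i, w i (σ i x.2) ≤ ∑ g ∈ B i, w i g) ∧
        (∀ g, (univ.filter fun i => g ∈ B i).card ≤ 2) ∧
        (univ.filter fun g => (univ.filter fun i => g ∈ B i).card = 2).card ≤ k by
    obtain ⟨B, -, hBw, hB2, hBk⟩ := key
      (univ.biUnion fun i => (A i ∩ range m).image fun j => (i, j)) (by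
        intro x hx
        simp only [Finset.mem_biUnion, Finset.mem_image, Finset.mem_inter, Finset.mem_range] at hx
        obtain ⟨i, -, j, hj, rfl⟩ := hx
        exact hj)
    refine ⟨B, fun i => ?_, hB2, hBk⟩
    convert hBw i using 1
    have : ((univ.biUnion fun i => (A i ∩ range m).image fun j => (i, j)).filter
        fun x => x.1 = i) = (A i ∩ range m).image fun j => (i, j) := by
      ext ⟨i', j⟩
      simp only [Finset.mem_filter, Finset.mem_biUnion, Finset.mem_image, Finset.mem_univ,
        true_and, Prod.mk.injEq]
      constructor
      · rintro ⟨⟨a, b, hb, rfl, rfl⟩, rfl⟩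
        exact ⟨b, hb, rfl, rfl⟩
      · rintro ⟨b, hb, rfl, rfl⟩
        exact ⟨⟨_, b, hb, rfl, rfl⟩, rfl⟩
    rw [this, Finset.sum_image fun a _ b _ hab => (Prod.mk.inj hab).2]
  intro X
  refine Finset.induction_on_max_value Prod.snd X (fun _ => ⟨fun _ => ∅, by simp⟩) ?_
  clear X
  intro x X hx hmax ih hX
  obtain ⟨i, j⟩ := x
  obtain ⟨B, hBcard, hBw, hB2, hBk⟩ := ih fun y hy => hX y (Finset.mem_insert_of_mem hy)
  obtain ⟨hjA, hjm⟩ := hX (i, j) (Finset.mem_insert_self _ _)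
  simp only at hjA hjm hmax
  set c : G → ℕ := fun g => (univ.filter fun i => g ∈ B i).card with hc
  set top := (range (j + 1)).image (σ i) with htop
  have htopcard : top.card = j + 1 := by
    rw [htop, Finset.card_image_of_injOn, Finset.card_range]
    exact (hσ i).mono fun a ha => by
      have := Finset.mem_range.1 (Finset.mem_coe.1 ha)
      exact Set.mem_Iio.2 (by omega)
  obtain ⟨g, hgtop, hgB, hg⟩ : ∃ g ∈ top, g ∉ B i ∧
      (c g = 0 ∨ c g = 1 ∧ (univ.filter fun g => c g = 2).card < k) := by
    by_cases hfree : ∃ g ∈ top, c g = 0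
    · obtain ⟨g, hg, hg0⟩ := hfree
      refine ⟨g, hg, fun h => ?_, Or.inl hg0⟩
      exact absurd (Finset.card_eq_zero.1 hg0) (Finset.ne_empty_of_mem (a := i) (by simpa using h))
    push Not at hfree
    have hsum : ∑ g, c g = X.card := by
      rw [Finset.card_eq_sum_card_fiberwise (f := Prod.fst) (t := univ) fun _ _ => by simp]
      simp only [hc, Finset.card_filter (p := fun i => _ ∈ B i)]
      rw [Finset.sum_comm]
      refine Finset.sum_congr rfl fun i' _ => ?_
      rw [← hBcard, Finset.card_eq_sum_ones, ← Finset.sum_filter]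
      simp
    have hXcard : X.card + 1 ≤ (j + 1) + (D ∩ range (j + 1)).card := by
      have h3 : X.card + 1 ≤ ∑ a ∈ range (j + 1), (univ.filter fun i => a ∈ A i).card := by
        rw [← Finset.card_insert_of_notMem hx, Finset.card_eq_sum_card_fiberwise (f := Prod.snd)
          (t := range (j + 1))]
        · refine Finset.sum_le_sum fun a _ => ?_
          refine Finset.card_le_card_of_injOn Prod.fst (fun y hy => ?_) fun y hy z hz hyz => ?_
          · obtain ⟨h4, rfl⟩ := Finset.mem_filter.1 hy
            simpa using (hX y h4).1
          · exact Prod.ext hyz ((Finset.mem_filter.1 hy).2.trans (Finset.mem_filter.1 hz).2.symm)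
        · intro y hy
          rw [Finset.mem_coe, Finset.mem_range]
          rcases Finset.mem_insert.1 hy with rfl | hy
          · exact Nat.lt_succ_self j
          · exact Nat.lt_succ_of_le (hmax y hy)
      have h4 : ∑ a ∈ range (j + 1), (univ.filter fun i => a ∈ A i).card ≤
          ∑ a ∈ range (j + 1), (1 + if a ∈ D then 1 else 0) := by
        refine Finset.sum_le_sum fun a _ => ?_
        split_ifs with h
        · exact h2 a
        · exact h1 a h
      rw [Finset.sum_add_distrib, ← Finset.card_filter, Finset.filter_mem_eq_inter,
        Finset.inter_comm] at h4
      simp only [Finset.sum_const, Finset.card_range, smul_eq_mul, mul_one] at h4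
      omega
    have hdup : j + 1 + (univ.filter fun g => c g = 2).card ≤ X.card := by
      rw [← hsum, ← htopcard, Finset.card_filter, Finset.card_eq_sum_ones,
        ← Finset.univ_inter top, ← Finset.filter_mem_eq_inter, Finset.sum_filter,
        ← Finset.sum_add_distrib]
      refine Finset.sum_le_sum fun g _ => ?_
      have := hfree g
      split_ifs <;> grind
    have hDk : (D ∩ range (j + 1)).card ≤ k :=
      (Finset.card_le_card Finset.inter_subset_left).trans hD
    by_contra! hcon
    have hone : ∀ g ∈ top, 2 ≤ c g + if g ∈ B i then 1 else 0 := by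
      intro g hg
      have h3 := hfree g hg
      split_ifs with h
      · omega
      · have := (hcon g hg h).2
        omega
    have hlow : 2 * (j + 1) ≤ X.card + (B i).card := by
      calc 2 * (j + 1) = ∑ _g ∈ top, 2 := by
            rw [Finset.sum_const, htopcard, smul_eq_mul, mul_comm]
        _ ≤ ∑ g ∈ top, (c g + if g ∈ B i then 1 else 0) := Finset.sum_le_sum hone
        _ ≤ ∑ g, (c g + if g ∈ B i then 1 else 0) :=
            Finset.sum_le_sum_of_subset (Finset.subset_univ _)
        _ = X.card + (B i).card := by
            rw [Finset.sum_add_distrib, hsum, ← Finset.card_filter, Finset.filter_univ_mem]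
    have hown : (B i).card + 1 ≤ (A i ∩ range (j + 1)).card := by
      rw [hBcard, ← Finset.card_insert_of_notMem (a := (i, j)) (s := X.filter fun x => x.1 = i)
        fun h => hx (Finset.mem_filter.1 h).1]
      refine Finset.card_le_card_of_injOn Prod.snd (fun y hy => ?_) fun y hy z hz hyz => ?_
      · rw [Finset.mem_coe, Finset.mem_inter, Finset.mem_range]
        rcases Finset.mem_insert.1 hy with rfl | hy
        · exact ⟨hjA, Nat.lt_succ_self j⟩
        · obtain ⟨hyX, hyi⟩ := Finset.mem_filter.1 hy
          exact ⟨hyi ▸ (hX y (Finset.mem_insert_of_mem hyX)).1, Nat.lt_succ_of_le (hmax y hyX)⟩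
      · have h3 : ∀ y ∈ insert (i, j) (X.filter fun x => x.1 = i), y.1 = i := by
          intro y hy
          rcases Finset.mem_insert.1 hy with rfl | hy
          · rfl
          · exact (Finset.mem_filter.1 hy).2
        exact Prod.ext ((h3 y hy).trans (h3 z hz).symm) hyz
    have := card_inter_add_card_inter_le (j := j) (hroom i)
    omega
  obtain ⟨hB2', hBk'⟩ := insert_good hB2 hBk (i := i) hg
  have hfself : ((insert (i, j) X).filter fun x => x.1 = i) =
      insert (i, j) (X.filter fun x => x.1 = i) := by
    rw [Finset.filter_insert, if_pos rfl]
  have hfother : ∀ i', i' ≠ i →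
      ((insert (i, j) X).filter fun x => x.1 = i') = X.filter fun x => x.1 = i' := by
    intro i' hi'
    rw [Finset.filter_insert, if_neg fun h => hi' h.symm]
  have hnot : (i, j) ∉ X.filter fun x => x.1 = i := fun h => hx (Finset.mem_filter.1 h).1
  refine ⟨Function.update B i (insert g (B i)), fun i' => ?_, fun i' => ?_, hB2', hBk'⟩
  · by_cases hi' : i' = i
    · subst hi'
      rw [Function.update_self, hfself, Finset.card_insert_of_notMem hgB,
        Finset.card_insert_of_notMem hnot, hBcard]
    · rw [Function.update_of_ne hi', hfother i' hi', hBcard]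
  · by_cases hi' : i' = i
    · subst hi'
      rw [Function.update_self, hfself, Finset.sum_insert hgB, Finset.sum_insert hnot]
      obtain ⟨a, ha, rfl⟩ := Finset.mem_image.1 hgtop
      exact add_le_add (hσw i' a j (Nat.lt_succ_iff.1 (Finset.mem_range.1 ha)) hjm) (hBw i')
    · rw [Function.update_of_ne hi', hfother i' hi']
      exact hBw i'

lemma exists_ranking {G : Type*} [Fintype G] [Nonempty G] (w : G → ℝ) :
    ∃ σ : ℕ → G, Set.InjOn σ (Set.Iio (Fintype.card G)) ∧
      (∀ g, ∃ r < Fintype.card G, σ r = g) ∧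
      ∀ a b, a ≤ b → b < Fintype.card G → w (σ b) ≤ w (σ a) := by
  set e := (Fintype.equivFin G).symm with he
  set τ := Tuple.sort fun a => -w (e a) with hτ
  have hmono : Monotone ((fun a => -w (e a)) ∘ τ) := Tuple.monotone_sort _
  let σ : ℕ → G := fun r =>
    if h : r < Fintype.card G then e (τ ⟨r, h⟩) else Classical.arbitrary G
  have hσ : ∀ r (h : r < Fintype.card G), σ r = e (τ ⟨r, h⟩) := fun r h => dif_pos h
  refine ⟨σ, fun a ha b hb hab => ?_, fun g => ?_, fun a b hab hb => ?_⟩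
  · rw [hσ a ha, hσ b hb] at hab
    exact congrArg Fin.val (τ.injective (e.injective hab))
  · exact ⟨τ.symm (e.symm g), Fin.is_lt _, by rw [hσ _ (Fin.is_lt _)]; simp⟩
  · rw [hσ b hb, hσ a (hab.trans_lt hb)]
    have := hmono (show (⟨a, hab.trans_lt hb⟩ : Fin (Fintype.card G)) ≤ ⟨b, hb⟩ from hab)
    simpa using this

lemma exists_mms_le {G : Type*} [Finite G] {n : ℕ} (hn : 0 < n) (v : Finset G → ℝ)
    (S : Finset G) : ∃ P : G → Fin n, ∀ j, mms v n S ≤ v (S.filter fun g => P g = j) := by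
  have : Nonempty (Fin n) := ⟨⟨0, hn⟩⟩
  obtain ⟨P, hP⟩ := exists_eq_ciSup_of_finite
    (f := fun P : G → Fin n => ⨅ j : Fin n, v (S.filter fun g => P g = j))
  refine ⟨P, fun j => ?_⟩
  rw [mms, ← hP]
  exact ciInf_le (Set.finite_range _).bddBelow j

/-- The values of the goods in decreasing order, scaled so that the maximin share becomes `5`. -/
lemma exists_scaled_ranking {G : Type*} [Fintype G] [Nonempty G] {n : ℕ} (hn : 0 < n)
    {w : G → ℝ} (hw : ∀ g, 0 ≤ w g) :
    ∃ (σ : ℕ → G) (v : ℕ → ℝ), Set.InjOn σ (Set.Iio (Fintype.card G)) ∧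
      (∀ a b, a ≤ b → b < Fintype.card G → w (σ b) ≤ w (σ a)) ∧ Antitone v ∧ (∀ g, 0 ≤ v g) ∧
      BundlesAvoiding v ∅ n ∧ ∀ α : ℝ, 0 ≤ α → α ≤ 4 / 5 → ∀ A : Finset ℕ, 4 ≤ ∑ r ∈ A, v r →
        α * mms (fun S => ∑ g ∈ S, w g) n univ ≤ ∑ r ∈ A ∩ range (Fintype.card G), w (σ r) := by
  obtain ⟨σ, hσ, hsurj, hanti⟩ := exists_ranking w
  set m := Fintype.card G with hm
  set μ := mms (fun S => ∑ g ∈ S, w g) n univ with hμ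
  rcases le_or_gt μ 0 with h0 | h0
  · refine ⟨σ, fun _ => 5, hσ, hanti, antitone_const, fun _ => by norm_num,
      ⟨range n, fun j => {j}, by simp, fun i _ j _ hij => by simpa using hij, by simp, by simp⟩,
      fun α hα _ A _ => ?_⟩
    exact (mul_nonpos_of_nonneg_of_nonpos hα h0).trans (Finset.sum_nonneg fun r _ => hw _)
  set v : ℕ → ℝ := fun r => if r < m then 5 / μ * w (σ r) else 0 with hv
  have hc : 0 < 5 / μ := by positivity
  have hnonneg : ∀ r, 0 ≤ v r := fun r => by
    simp only [hv]
    split_ifs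
    · exact mul_nonneg hc.le (hw _)
    · exact le_rfl
  have hsum : ∀ A : Finset ℕ, ∑ r ∈ A, v r = 5 / μ * ∑ r ∈ A ∩ range m, w (σ r) := by
    intro A
    rw [Finset.mul_sum, ← Finset.filter_mem_eq_inter, Finset.sum_filter]
    simp only [hv, Finset.mem_range]
  refine ⟨σ, v, hσ, hanti, fun a b hab => ?_, hnonneg, ?_, fun α _ hα A hA => ?_⟩
  · by_cases hb : b < m
    · simp only [hv, if_pos hb, if_pos (hab.trans_lt hb)]
      exact mul_le_mul_of_nonneg_left (hanti a b hab hb) hc.le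
    · rw [show v b = 0 from if_neg hb]
      exact hnonneg a
  · classical
    obtain ⟨P, hP⟩ := exists_mms_le hn (fun S => ∑ g ∈ S, w g) univ
    refine ⟨range n, fun j => (range m).filter fun r => (P (σ r) : ℕ) = j, by simp, ?_, by simp,
      fun j hj => ?_⟩
    · intro i _ j _ hij
      rw [Finset.disjoint_left]
      intro r hr hr'
      exact hij ((Finset.mem_filter.1 hr).2.symm.trans (Finset.mem_filter.1 hr').2)
    · have himg : ((range m).filter fun r => (P (σ r) : ℕ) = j).image σ =
          univ.filter fun g => P g = ⟨j, Finset.mem_range.1 hj⟩ := by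
        ext g
        simp only [Finset.mem_image, Finset.mem_filter, Finset.mem_range, Finset.mem_univ,
          true_and, Fin.ext_iff]
        constructor
        · rintro ⟨r, ⟨-, hr⟩, rfl⟩
          exact hr
        · intro hg
          obtain ⟨r, hr, rfl⟩ := hsurj g
          exact ⟨r, ⟨hr, hg⟩, rfl⟩
      have h1 := hP ⟨j, Finset.mem_range.1 hj⟩
      rw [← himg, Finset.sum_image fun a ha b hb => hσ
        (Finset.mem_range.1 (Finset.mem_filter.1 ha).1)
        (Finset.mem_range.1 (Finset.mem_filter.1 hb).1)] at h1
      rw [hsum, Finset.inter_eq_left.2 (Finset.filter_subset _ _)]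
      calc (5 : ℝ) = 5 / μ * μ := by field_simp
        _ ≤ _ := mul_le_mul_of_nonneg_left h1 hc.le
  · rw [hsum, div_mul_eq_mul_div, le_div_iff₀ h0] at hA
    have := mul_le_mul_of_nonneg_right hα h0.le
    linarith

/-- Every instance with `n > 5` agents and additive valuations admits, for any
`0 ≤ α ≤ 4/5`, an `α`-MMS allocation with copies in which every good belongs to at most two
bundles and at most `⌊n/3⌋` goods belong to two bundles. -/
theorem stmt17 {G : Type*} [Fintype G] [DecidableEq G] (n : ℕ) (hn : 5 < n)
    (w : Fin n → G → ℝ) (hw : ∀ i g, 0 ≤ w i g)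
    (α : ℝ) (hα0 : 0 ≤ α) (hα1 : α ≤ 4 / 5) :
    ∃ A : Fin n → Finset G,
      (∀ i, α * mms (fun S => ∑ g ∈ S, w i g) n Finset.univ ≤ ∑ g ∈ A i, w i g) ∧
      (∀ g : G, (Finset.univ.filter fun i => g ∈ A i).card ≤ 2) ∧
      (Finset.univ.filter fun g : G =>
        (Finset.univ.filter fun i => g ∈ A i).card = 2).card ≤ n / 3 := by
  have hn0 : 0 < n := by omega
  rcases isEmpty_or_nonempty G with hG | hG
  · refine ⟨fun _ => ∅, fun i => ?_, by simp, by simp⟩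
    obtain ⟨P, hP⟩ := exists_mms_le hn0 (fun S => ∑ g ∈ S, w i g) univ
    have h0 := (hP ⟨0, hn0⟩).trans_eq (Finset.sum_eq_zero fun g _ => isEmptyElim g)
    exact mul_nonpos_of_nonneg_of_nonpos hα0 h0
  choose σ v hσ hσw hv hv0 hB hα using fun i => exists_scaled_ranking hn0 (hw i)
  obtain ⟨A, D, hs⟩ := exists_isSolution (𝒜 := univ) (v := v) (n := n) (k := n / 3) (by simp)
    (by omega) hv hv0 fun i _ => hB i
  obtain ⟨B, hBw, hB2, hBk⟩ := exists_allocation_of_ranks hσ hσw hs.card_le hs.two hs.one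
    fun i => hs.room i (Finset.mem_univ i)
  exact ⟨B, fun i => (hα i α hα0 hα1 (A i) (hs.value i (Finset.mem_univ i))).trans (hBw i),
    hB2, hBk⟩
end
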